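/- In the clipping ANN setting, assume additionally that f and p are piecewise polynomial, and let θ ∈ ℝ^{h+1}. Then there exist ε, c ∈ (0, ∞) and 𝔞₀ ∈ (0, 1) such that for all ϑ ∈ ℝ^{h+1} with ‖ϑ − θ‖ < ε and all 𝔞 ∈ (𝔞₀, 1] it holds that |L(θ) − L(ϑ)|^𝔞 ≤ c ‖(∇L)(ϑ)‖, where ‖·‖ denotes the Euclidean norm. -/

import Mathlib

open MeasureTheory Filter

noncomputable section

/-- The clipping function `x ↦ min{max{x,0},1}`. -/
def clipFn (x : ℝ) : ℝ := min (max x 0) 1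

/-- `ψ_i(θ) = -θ_i / w_i`. -/
def psiC {h : ℕ} (w : Fin h → ℝ) (θ : Fin (h + 1) → ℝ) (i : Fin h) : ℝ :=
  -θ i.castSucc / w i

/-- The activity interval `I_i^θ = (ψ_i(θ), ψ_i(θ) + 1/w_i) ∩ (a, b)`. -/
def actI {h : ℕ} (a b : ℝ) (w : Fin h → ℝ) (θ : Fin (h + 1) → ℝ) (i : Fin h) : Set ℝ :=
  Set.Ioo (psiC w θ i) (psiC w θ i + (w i)⁻¹) ∩ Set.Ioo a b

/-- The realization function `N^θ(x) = θ_{h+1} + ∑_i v_i c(w_i x + θ_i)`. -/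
def realC {h : ℕ} (v w : Fin h → ℝ) (θ : Fin (h + 1) → ℝ) (x : ℝ) : ℝ :=
  θ (Fin.last h) + ∑ i : Fin h, v i * clipFn (w i * x + θ i.castSucc)

/-- The risk `L(θ) = ∫_a^b (N^θ(x) - f(x))² p(x) dx`. -/
def riskC {h : ℕ} (a b : ℝ) (v w : Fin h → ℝ) (f p : ℝ → ℝ) (θ : Fin (h + 1) → ℝ) : ℝ :=
  ∫ x in Set.Ioo a b, (realC v w θ x - f x) ^ 2 * p x

/-- The gradient `∇L(θ)` as a vector of partial derivatives. -/
def gradC {h : ℕ} (a b : ℝ) (v w : Fin h → ℝ) (f p : ℝ → ℝ) (θ : Fin (h + 1) → ℝ) :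
    Fin (h + 1) → ℝ :=
  fun k => fderiv ℝ (riskC a b v w f p) θ (Pi.single k 1)

/-- `x` is a descending critical point of `g` : `∇g(x) = 0` and the Hessian quadratic form
admits a negative value. -/
def IsDescCrit {n : ℕ} (g : (Fin n → ℝ) → ℝ) (x : Fin n → ℝ) : Prop :=
  fderiv ℝ g x = 0 ∧ ∃ u : Fin n → ℝ, iteratedFDeriv ℝ 2 g x ![u, u] < 0

/-- The Euclidean norm on `Fin n → ℝ`. -/
def euclNorm {n : ℕ} (x : Fin n → ℝ) : ℝ := Real.sqrt (∑ i, (x i) ^ 2)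

/-- Piecewise polynomial functions. -/
def PiecewisePoly (F : ℝ → ℝ) : Prop :=
  ∃ (K : ℕ) (τ : ℕ → EReal), 0 < K ∧ τ 0 = ⊥ ∧ τ K = ⊤ ∧
    (∀ k, k < K → τ k < τ (k + 1)) ∧
    ∀ k, k < K → ∃ q : Polynomial ℝ, ∀ x : ℝ,
      τ k < (x : EReal) → (x : EReal) < τ (k + 1) → F x = q.eval x

open TensorProduct in
theorem exists_derivation_algebraicIndependent {k E ι : Type*} [Field k] [CharZero k] [Field E]
    [Algebra k E] [Algebra.EssFiniteType k E] {x : ι → E}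
    (hx : AlgebraicIndependent k x) (c : ι → E) :
    ∃ D : Derivation k E E, ∀ i, D (x i) = c i := by
  let _ : Algebra (MvPolynomial ι k) E := (MvPolynomial.aeval x).toAlgebra
  have : IsScalarTower k (MvPolynomial ι k) E := .of_algebraMap_eq fun r => by
    simp [RingHom.algebraMap_toAlgebra]
  have hinj : Function.Injective (algebraMap (MvPolynomial ι k) E) := hx
  let F := FractionRing (MvPolynomial ι k)
  have : FaithfulSMul (MvPolynomial ι k) E := (faithfulSMul_iff_algebraMap_injective _ _).mpr hinj
  let _ : Algebra F E := FractionRing.liftAlgebra _ _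
  have : CharZero F := charZero_of_injective_algebraMap (algebraMap k F).injective
  have : Algebra.FormallyEtale (MvPolynomial ι k) F :=
    Algebra.FormallyEtale.of_isLocalization (nonZeroDivisors (MvPolynomial ι k))
  have : Algebra.EssFiniteType F E := .of_comp k F E
  have : Algebra.FormallySmooth (MvPolynomial ι k) E := .comp _ F E
  have hker : Function.Injective (KaehlerDifferential.mapBaseChange k (MvPolynomial ι k) E) := by
    rw [injective_iff_map_eq_zero]
    intro z hz
    obtain ⟨z, rfl⟩ :=
      (Algebra.H1Cotangent.exact_δ_mapBaseChange k (MvPolynomial ι k) E z).mp hz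
    rw [Subsingleton.elim z 0, map_zero]
  obtain ⟨g, hg⟩ := LinearMap.exists_leftInverse_of_injective _ (LinearMap.ker_eq_bot.mpr hker)
  let d : Derivation k (MvPolynomial ι k) E := MvPolynomial.mkDerivation k c
  let φ : E ⊗[MvPolynomial ι k] Ω[MvPolynomial ι k⁄k] →ₗ[E] E :=
    d.liftKaehlerDifferential.liftBaseChange E
  refine ⟨(φ ∘ₗ g).compDer (KaehlerDifferential.D k E), fun i => ?_⟩
  have h1 : x i = algebraMap (MvPolynomial ι k) E (MvPolynomial.X i) := by
    simp [RingHom.algebraMap_toAlgebra]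
  have h2 : KaehlerDifferential.D k E (x i) = KaehlerDifferential.mapBaseChange k _ E
      (1 ⊗ₜ KaehlerDifferential.D k (MvPolynomial ι k) (MvPolynomial.X i)) := by
    rw [KaehlerDifferential.mapBaseChange_tmul, one_smul, KaehlerDifferential.map_D, h1]
  have h3 := LinearMap.congr_fun hg
    (1 ⊗ₜ KaehlerDifferential.D k (MvPolynomial ι k) (MvPolynomial.X i))
  simp only [LinearMap.comp_apply, LinearMap.id_apply] at h3
  change φ (g (KaehlerDifferential.D k E (x i))) = c i
  rw [h2, h3]
  simp [φ, d]

theorem IsAlgebraic.exists_aeval_derivative_ne_zero {M K : Type*} [CommRing M] [IsDomain M]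
    [CharZero M] [Field K] [Algebra M K] [FaithfulSMul M K] {a : K} (ha : IsAlgebraic M a) :
    ∃ P : Polynomial M, Polynomial.aeval a P = 0 ∧
      Polynomial.aeval a (Polynomial.derivative P) ≠ 0 := by
  classical
  have hex : ∃ d, ∃ P : Polynomial M, P ≠ 0 ∧ Polynomial.aeval a P = 0 ∧ P.natDegree = d := by
    obtain ⟨P, h0, h1⟩ := ha
    exact ⟨_, P, h0, h1, rfl⟩
  obtain ⟨P, hP0, hPa, hPd⟩ := Nat.find_spec hex
  refine ⟨P, hPa, fun hder => ?_⟩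
  have hdeg : P.natDegree ≠ 0 := by
    intro hd
    rw [Polynomial.eq_C_of_natDegree_eq_zero hd] at hPa hP0
    rw [Polynomial.aeval_C, FaithfulSMul.algebraMap_eq_zero_iff] at hPa
    exact hP0 (by rw [hPa, Polynomial.C_0])
  have hder0 : Polynomial.derivative P ≠ 0 := fun h0 =>
    hdeg (Polynomial.derivative_eq_zero.mp h0)
  have hlt := Polynomial.natDegree_derivative_lt hdeg
  exact Nat.find_min hex (hPd ▸ hlt) ⟨_, hder0, hder, rfl⟩

section DVR

variable {k V E : Type*} [Field k] [CommRing V] [IsDomain V]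
  [IsDiscreteValuationRing V] [Field E] [Algebra V E] [IsFractionRing V E] [Algebra k V]
  [Algebra k E] [IsScalarTower k V E]

open IsLocalRing

theorem transcendental_uniformizer {B : Subalgebra k V} {π : V} (hπ : Irreducible π)
    (hB : Function.Injective ((residue V).comp B.val.toRingHom)) : Transcendental B π := by
  rintro ⟨P, hP0, hP⟩
  obtain ⟨Q, hQ, hnd⟩ := Polynomial.exists_eq_pow_rootMultiplicity_mul_and_not_dvd P hP0 0
  have hQ0 : Polynomial.aeval π Q = 0 := by
    rw [hQ] at hP
    simpa [hπ.ne_zero] using hP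
  have hc : Q.coeff 0 ≠ 0 := by
    rw [Polynomial.dvd_iff_isRoot, Polynomial.IsRoot, ← Polynomial.coeff_zero_eq_eval_zero] at hnd
    exact hnd
  apply hc
  apply hB
  have h1 := congrArg (Polynomial.aeval π) (Polynomial.divX_mul_X_add Q)
  rw [hQ0, map_add, map_mul, Polynomial.aeval_X, Polynomial.aeval_C] at h1
  have h2 : residue V π = 0 := (residue_eq_zero_iff π).mpr
    ((mem_maximalIdeal π).mpr hπ.not_isUnit)
  have h3 := congrArg (residue V) h1
  rw [map_add, map_mul, h2, mul_zero, zero_add, map_zero] at h3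
  rw [map_zero]
  exact h3

theorem exists_uniformizer_pow_mul (π : V) (hπ : Irreducible π) (z : E) :
    ∃ (N : ℕ) (b : V), algebraMap V E π ^ N * z = algebraMap V E b := by
  obtain ⟨c, d, hd, rfl⟩ := IsFractionRing.div_surjective (A := V) z
  obtain ⟨N, u, rfl⟩ := IsDiscreteValuationRing.eq_unit_mul_pow_irreducible
    (nonZeroDivisors.ne_zero hd) hπ
  refine ⟨N, c * ↑u⁻¹, ?_⟩
  have h1 : algebraMap V E π ≠ 0 := by simpa using hπ.ne_zero
  have h2 : algebraMap V E u ≠ 0 := by simp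
  have h3 : algebraMap V E u * algebraMap V E ↑u⁻¹ = 1 := by
    rw [← map_mul, Units.mul_inv, map_one]
  rw [map_mul, map_mul, map_pow]
  field_simp
  linear_combination (-algebraMap V E c) * h3

theorem exists_uniformizer_pow_mul_derivation [Algebra.EssFiniteType k V] (π : V)
    (hπ : Irreducible π) (D : Derivation k E E) :
    ∃ N : ℕ, ∀ a : V, ∃ b : V, algebraMap V E π ^ N * D (algebraMap V E a) = algebraMap V E b := by
  classical
  choose n b hb using fun a : V => exists_uniformizer_pow_mul π hπ (D (algebraMap V E a))
  let s := Algebra.EssFiniteType.finset k V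
  let N := s.sup n
  let W : Subalgebra k V :=
    { carrier := {a | ∃ b : V, algebraMap V E π ^ N * D (algebraMap V E a) = algebraMap V E b}
      mul_mem' := by
        rintro x y ⟨c, hc⟩ ⟨d, hd⟩
        refine ⟨x * d + y * c, ?_⟩
        simp only [map_mul, Derivation.leibniz, smul_eq_mul, map_add, ← hc, ← hd]
        ring
      add_mem' := by
        rintro x y ⟨c, hc⟩ ⟨d, hd⟩
        exact ⟨c + d, by simp only [map_add, mul_add, hc, hd]⟩
      algebraMap_mem' := fun r => ⟨0, by
        rw [← IsScalarTower.algebraMap_apply, Derivation.map_algebraMap, mul_zero, map_zero]⟩ }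
  have hW : Algebra.EssFiniteType.subalgebra k V ≤ W := by
    refine Algebra.adjoin_le fun a ha => ?_
    obtain ⟨m, hm⟩ := Nat.exists_eq_add_of_le (Finset.le_sup (f := n) ha)
    exact ⟨π ^ m * b a, by
      change algebraMap V E π ^ (s.sup n) * _ = _
      rw [hm, map_mul, ← hb, map_pow]; ring⟩
  refine ⟨N, fun a => ?_⟩
  obtain ⟨⟨c, m⟩, hcm⟩ := IsLocalization.surj (Algebra.EssFiniteType.submonoid k V) a
  obtain ⟨d, hd⟩ := hW c.2
  obtain ⟨e, he⟩ := hW m.1.2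
  obtain ⟨u, hu⟩ : IsUnit (m.1.1 : V) := m.2
  have hcm' : a * m.1.1 = c.1 := hcm
  refine ⟨↑u⁻¹ * (d - a * e), ?_⟩
  have h3 : algebraMap V E m.1.1 * algebraMap V E ↑u⁻¹ = 1 := by
    rw [← map_mul, ← hu, Units.mul_inv, map_one]
  have h4 : D (algebraMap V E a * algebraMap V E m.1.1) = D (algebraMap V E c.1) := by
    rw [← map_mul, hcm']
  rw [Derivation.leibniz, smul_eq_mul, smul_eq_mul] at h4
  rw [map_mul, map_sub, map_mul, ← hd, ← he]
  linear_combination (-(algebraMap V E π ^ N * D (algebraMap V E a))) * h3 +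
    (algebraMap V E π ^ N * algebraMap V E ↑u⁻¹) * h4

/-- The derivation `∂/∂π` along a uniformizer of an essentially finite type discrete
valuation ring. -/
theorem exists_derivation_uniformizer [CharZero k] [Algebra.EssFiniteType k V] (π : V)
    (hπ : Irreducible π) :
    ∃ D : Derivation k E E, D (algebraMap V E π) = 1 ∧
      ∀ a : V, ∃ b : V, D (algebraMap V E a) = algebraMap V E b := by
  obtain ⟨ι, x, hx⟩ := exists_isTranscendenceBasis' k (ResidueField V)
  choose y hy using fun i => residue_surjective (x i)
  have hyx : (IsScalarTower.toAlgHom k V (ResidueField V)) ∘ y = x := funext hy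
  have hyind : AlgebraicIndependent k y :=
    AlgebraicIndependent.of_comp (IsScalarTower.toAlgHom k V (ResidueField V)) (hyx ▸ hx.1)
  have hcomp : ∀ q, residue V (MvPolynomial.aeval y q) = MvPolynomial.aeval x q := fun q => by
    rw [← funext hy]
    exact MvPolynomial.comp_aeval_apply y (IsScalarTower.toAlgHom k V (ResidueField V)) q
  have htr : Transcendental (Algebra.adjoin k (Set.range y)) π := by
    refine transcendental_uniformizer hπ ((injective_iff_map_eq_zero _).mpr ?_)
    rintro ⟨b, hb⟩ h0
    rw [Algebra.adjoin_range_eq_range_aeval] at hb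
    obtain ⟨q, rfl⟩ := hb
    have : MvPolynomial.aeval x q = 0 := by
      rw [← hcomp]
      exact h0
    have : q = 0 := hx.1 (by rw [this, map_zero])
    exact Subtype.ext (by simp [this])
  have hEind := ((hyind.option_iff_transcendental π).mpr htr).map'
    (f := IsScalarTower.toAlgHom k V E) (IsFractionRing.injective V E)
  have : Algebra.EssFiniteType V E := .of_isLocalization E (nonZeroDivisors V)
  have : Algebra.EssFiniteType k E := .comp k V E
  obtain ⟨D, hD⟩ := exists_derivation_algebraicIndependent hEind
    (fun o => o.elim 1 fun _ => 0)
  have hDπ : D (algebraMap V E π) = 1 := hD none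
  have hDy : ∀ i, D (algebraMap V E (y i)) = 0 := fun i => hD (some i)
  refine ⟨D, hDπ, ?_⟩
  let _ : Algebra (MvPolynomial ι k) V := (MvPolynomial.aeval y).toAlgebra
  let _ : Algebra (MvPolynomial ι k) E := ((algebraMap V E).comp (algebraMap _ V)).toAlgebra
  let _ : Algebra (MvPolynomial ι k) (ResidueField V) :=
    ((residue V).comp (algebraMap _ V)).toAlgebra
  have : IsScalarTower (MvPolynomial ι k) V E := .of_algebraMap_eq fun _ => rfl
  have : IsScalarTower (MvPolynomial ι k) V (ResidueField V) := .of_algebraMap_eq fun _ => rfl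
  have hmap : ∀ q : MvPolynomial ι k, algebraMap _ (ResidueField V) q = MvPolynomial.aeval x q :=
    hcomp
  have hDM : ∀ q : MvPolynomial ι k, D (algebraMap _ E q) = 0 := by
    intro q
    induction q using MvPolynomial.induction_on with
    | C r =>
      have : algebraMap (MvPolynomial ι k) E (MvPolynomial.C r) = algebraMap k E r := by
        rw [IsScalarTower.algebraMap_apply k V E, IsScalarTower.algebraMap_apply _ V E]
        simp [RingHom.algebraMap_toAlgebra]
      rw [this, Derivation.map_algebraMap]
    | add p q hp hq => rw [map_add, map_add, hp, hq, add_zero]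
    | mul_X p i hp =>
      have : algebraMap (MvPolynomial ι k) E (MvPolynomial.X i) = algebraMap V E (y i) := by
        rw [IsScalarTower.algebraMap_apply _ V E]
        simp [RingHom.algebraMap_toAlgebra]
      rw [map_mul, Derivation.leibniz, hp, this, hDy, smul_zero, smul_zero, add_zero]
  let D' : Derivation (MvPolynomial ι k) E E := Derivation.mk'
    { toFun := D
      map_add' := map_add D
      map_smul' := fun q z => by
        simp [Algebra.smul_def, hDM] } fun a b => D.leibniz a b
  have hinj : Function.Injective (algebraMap (MvPolynomial ι k) (ResidueField V)) := fun p q hpq =>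
    hx.1 (by rwa [hmap, hmap] at hpq)
  have : FaithfulSMul (MvPolynomial ι k) (ResidueField V) :=
    (faithfulSMul_iff_algebraMap_injective _ _).mpr hinj
  have halg : ∀ a : ResidueField V, IsAlgebraic (MvPolynomial ι k) a := by
    intro a
    obtain ⟨P, hP0, hP⟩ := hx.isAlgebraic.isAlgebraic a
    refine ⟨P.map hx.1.aevalEquiv.symm.toRingEquiv.toRingHom, ?_, ?_⟩
    · exact (Polynomial.map_ne_zero_iff hx.1.aevalEquiv.symm.injective).mpr hP0
    · rw [Polynomial.aeval_def, Polynomial.eval₂_map, ← hP, Polynomial.aeval_def]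
      congr 1
      ext q
      rw [RingHom.comp_apply, hmap]
      change MvPolynomial.aeval x (hx.1.aevalEquiv.symm q) = (q : ResidueField V)
      rw [← hx.1.algebraMap_aevalEquiv, AlgEquiv.apply_symm_apply]
      rfl
  obtain ⟨N, hN⟩ := exists_uniformizer_pow_mul_derivation π hπ D
  induction N with
  | zero => simpa using hN
  | succ N ih =>
    refine ih fun a => ?_
    obtain ⟨P, hP, hP'⟩ := (halg (residue V a)).exists_aeval_derivative_ne_zero
    have hres : ∀ Q : Polynomial (MvPolynomial ι k),
        Polynomial.aeval (residue V a) Q = residue V (Polynomial.aeval a Q) := fun Q =>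
      Polynomial.aeval_algebraMap_apply (ResidueField V) a Q
    rw [hres] at hP hP'
    rw [residue_eq_zero_iff, hπ.maximalIdeal_eq, Ideal.mem_span_singleton] at hP
    obtain ⟨b, hb⟩ := hP
    obtain ⟨u, hu⟩ : IsUnit (Polynomial.aeval a (Polynomial.derivative P)) := by
      rwa [ne_eq, residue_eq_zero_iff, mem_maximalIdeal, mem_nonunits_iff, not_not] at hP'
    obtain ⟨c, hc⟩ := hN b
    have h1 := D'.map_aeval P (algebraMap V E a)
    rw [Polynomial.aeval_algebraMap_apply, Polynomial.aeval_algebraMap_apply, hb, ← hu] at h1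
    have h2 : D (algebraMap V E (π * b)) = algebraMap V E u * D (algebraMap V E a) := h1
    rw [map_mul, Derivation.leibniz, hDπ, smul_eq_mul, smul_eq_mul] at h2
    have h3 : algebraMap V E u * algebraMap V E ↑u⁻¹ = 1 := by
      rw [← map_mul, Units.mul_inv, map_one]
    refine ⟨↑u⁻¹ * (c + π ^ N * b), ?_⟩
    rw [map_mul, map_add, ← hc, map_mul, map_pow]
    linear_combination (-(algebraMap V E π ^ N * D (algebraMap V E a))) * h3 -
      (algebraMap V E π ^ N * algebraMap V E ↑u⁻¹) * h2

end DVR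

theorem exists_isDiscreteValuationRing_atPrime {R : Type*} [CommRing R] [IsDomain R]
    [IsNoetherianRing R] [IsIntegrallyClosed R] {f : R} (hf0 : f ≠ 0) (hf : ¬IsUnit f) :
    ∃ (p : Ideal R) (_ : p.IsPrime), f ∈ p ∧
      IsDiscreteValuationRing (Localization.AtPrime p) := by
  obtain ⟨m, hm, hfm⟩ := Ideal.exists_le_maximal _ (mt Ideal.span_singleton_eq_top.mp hf)
  obtain ⟨p, hp, -⟩ := Ideal.exists_minimalPrimes_le (I := Ideal.span {f}) (J := m) hfm
  have hpp : p.IsPrime := hp.isPrime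
  have hfp : f ∈ p := hp.1.2 (Ideal.mem_span_singleton_self f)
  refine ⟨p, hpp, hfp, ?_⟩
  have hle : p.primeCompl ≤ nonZeroDivisors R := p.primeCompl_le_nonZeroDivisors
  have hht : p.height ≤ 1 :=
    Ideal.height_le_one_of_isPrincipal_of_mem_minimalPrimes (Ideal.span {f}) p hp
  have : IsIntegrallyClosed (Localization.AtPrime p) :=
    isIntegrallyClosed_of_isLocalization _ p.primeCompl hle
  have : IsNoetherianRing (Localization.AtPrime p) :=
    IsLocalization.isNoetherianRing p.primeCompl _ inferInstance
  have hinj := IsLocalization.injective (Localization.AtPrime p) hle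
  have hPID : IsPrincipalIdealRing (Localization.AtPrime p) := by
    have key := ((tfae_of_isNoetherianRing_of_isLocalRing_of_isDomain
      (Localization.AtPrime p)).out 3 0).mp
    refine key ⟨inferInstance, fun P hP hPp => ?_⟩
    refine (Localization.AtPrime.eq_maximalIdeal_iff_under_eq (I := p)).mp ?_
    have hPle : P.under R ≤ p :=
      (Ideal.comap_mono (IsLocalRing.le_maximalIdeal hPp.ne_top)).trans_eq
        Localization.AtPrime.under_maximalIdeal
    by_contra hne
    have h1 := (Ideal.height_strict_mono_of_isPrime (lt_of_le_of_ne hPle hne)).trans_le hht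
    rw [Order.lt_one_iff, Ideal.height_eq_zero_iff_eq_bot] at h1
    exact hP (by rw [← IsLocalization.map_under p.primeCompl _ P, h1, Ideal.map_bot])
  have hne : IsLocalRing.maximalIdeal (Localization.AtPrime p) ≠ ⊥ := fun h0 => by
    have h1 : algebraMap R (Localization.AtPrime p) f ∈ IsLocalRing.maximalIdeal _ :=
      (IsLocalization.AtPrime.to_map_mem_maximal_iff _ p f _).mpr hfp
    rw [h0, Ideal.mem_bot, map_eq_zero_iff _ hinj] at h1
    exact hf0 h1
  exact { hPID with not_a_field' := hne }

theorem exists_subalgebra_derivation_of_dvr {k V E : Type*} [Field k] [CharZero k] [CommRing V]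
    [IsDomain V] [IsDiscreteValuationRing V] [Field E] [Algebra V E] [IsFractionRing V E]
    [Algebra k V] [Algebra k E] [IsScalarTower k V E] [Algebra.EssFiniteType k V] {f : V}
    (hf0 : f ≠ 0) (hf : ¬IsUnit f) :
    ∃ D : Derivation k E E, (∀ a : V, ∃ b : V, D (algebraMap V E a) = algebraMap V E b) ∧
      ∀ b : V, D (algebraMap V E f) ≠ algebraMap V E (f * b) := by
  obtain ⟨π, hπ⟩ := IsDiscreteValuationRing.exists_irreducible V
  obtain ⟨D, hDπ, hD⟩ := exists_derivation_uniformizer (k := k) (E := E) π hπ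
  refine ⟨D, hD, fun b hb => ?_⟩
  obtain ⟨e, u, rfl⟩ := IsDiscreteValuationRing.eq_unit_mul_pow_irreducible hf0 hπ
  cases e with
  | zero => exact hf (by simp)
  | succ e =>
    obtain ⟨d, hd⟩ := hD u
    have hinj := IsFractionRing.injective V E
    have h1 : π ^ e * (π * d + (e + 1 : ℕ) * u) = π ^ e * (π * (u * b)) := by
      apply hinj
      rw [map_mul, Derivation.leibniz, hd, map_pow, Derivation.leibniz_pow, hDπ] at hb
      simp only [map_mul, map_add, map_pow, smul_eq_mul, nsmul_eq_mul, map_natCast] at hb ⊢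
      simp only [Nat.add_sub_cancel] at hb
      linear_combination hb
    have h2 := mul_left_cancel₀ (pow_ne_zero e hπ.ne_zero) h1
    have h3 : π ∣ ((e + 1 : ℕ) : V) * u := ⟨u * b - d, by linear_combination h2⟩
    have h4 : IsUnit (((e + 1 : ℕ) : V)) := by
      have : IsUnit (algebraMap k V ((e + 1 : ℕ) : k)) :=
        (IsUnit.mk0 _ (Nat.cast_ne_zero.mpr e.succ_ne_zero)).map _
      rwa [map_natCast] at this
    exact hπ.not_isUnit (isUnit_of_dvd_unit h3 (h4.mul u.isUnit))

theorem exists_subalgebra_derivation {k E : Type*} [Field k] [CharZero k] [Field E] [Algebra k E]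
    (C : Subalgebra k E) [Algebra.FiniteType k C] [IsFractionRing C E] {f : C}
    (hf0 : f ≠ 0) (hf : ¬IsIntegral C (f : E)⁻¹) :
    ∃ (W : Subalgebra k E) (D : Derivation k E E), C ≤ W ∧ (∀ a ∈ W, D a ∈ W) ∧
      ∀ b ∈ W, D f ≠ f * b := by
  obtain ⟨s, g, hginj, hgfin⟩ := exists_finite_inj_algHom_of_fg k C
  let M := MvPolynomial (Fin s) k
  let _ : Algebra M C := g.toRingHom.toAlgebra
  let _ : Algebra M E := ((algebraMap C E).comp g.toRingHom).toAlgebra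
  have : IsScalarTower M C E := .of_algebraMap_eq fun _ => rfl
  have : IsScalarTower k M C := .of_algebraMap_eq fun r => (g.commutes r).symm
  have : IsScalarTower k M E := .of_algebraMap_eq fun r => by
    rw [IsScalarTower.algebraMap_apply M C E, ← IsScalarTower.algebraMap_apply k M C,
      ← IsScalarTower.algebraMap_apply k C E]
  have : Module.Finite M C := hgfin
  have hMC : Function.Injective (algebraMap M C) := hginj
  have hME : Function.Injective (algebraMap M E) :=
    (IsFractionRing.injective C E).comp hginj
  have : FaithfulSMul M E := (faithfulSMul_iff_algebraMap_injective _ _).mpr hME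
  have : FaithfulSMul M C := (faithfulSMul_iff_algebraMap_injective _ _).mpr hMC
  let K := FractionRing M
  let _ : Algebra K E := FractionRing.liftAlgebra _ _
  have : Algebra.IsAlgebraic C E := IsLocalization.isAlgebraic _ (nonZeroDivisors C)
  have : Algebra.IsAlgebraic M E := .trans M C E
  have : Algebra.IsAlgebraic K E := IsFractionRing.comap_isAlgebraic_iff.mp this
  have : Algebra.EssFiniteType C E := .of_isLocalization E (nonZeroDivisors C)
  have : Algebra.EssFiniteType k E := .comp k C E
  have : Algebra.EssFiniteType K E := .of_comp k K E
  have : FiniteDimensional K E := Algebra.finite_of_essFiniteType_of_isAlgebraic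
  have : CharZero K := charZero_of_injective_algebraMap (algebraMap k K).injective
  let B := integralClosure M E
  have : IsFractionRing B E := integralClosure.isFractionRing_of_finite_extension K E
  have : IsIntegrallyClosed B := integralClosure.isIntegrallyClosedOfFiniteExtension K
  have : Module.Finite M B := IsIntegralClosure.finite M K E B
  have : IsNoetherianRing B := IsIntegralClosure.isNoetherianRing M K E B
  have : Algebra.FiniteType k B := .trans (S := M) inferInstance inferInstance
  have hCB : ∀ c : C, (c : E) ∈ B := fun c => (Algebra.IsIntegral.isIntegral (R := M) c).algebraMap
  let fB : B := ⟨f, hCB f⟩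
  have hfE : (f : E) ≠ 0 := by simpa using hf0
  have hfB0 : fB ≠ 0 := fun h0 => hfE (congrArg Subtype.val h0)
  have hfB : ¬IsUnit fB := by
    rintro ⟨u, hu⟩
    apply hf
    have h1 : (f : E) * (↑u⁻¹ : B) = 1 := by
      have := congrArg Subtype.val u.mul_inv
      rw [hu] at this
      exact this
    rw [← eq_inv_of_mul_eq_one_right h1]
    exact IsIntegral.tower_top (R := M) (↑u⁻¹ : B).2
  obtain ⟨p, hp, hfp, hV⟩ := exists_isDiscreteValuationRing_atPrime hfB0 hfB
  let V := Localization.AtPrime p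
  have hle : p.primeCompl ≤ nonZeroDivisors B := p.primeCompl_le_nonZeroDivisors
  have hM : ∀ y : p.primeCompl, IsUnit (algebraMap B E y) := fun y =>
    IsLocalization.map_units E (⟨y, hle y.2⟩ : nonZeroDivisors B)
  let _ : Algebra V E := (IsLocalization.lift (S := V) hM).toAlgebra
  have : IsScalarTower B V E := .of_algebraMap_eq fun x => (IsLocalization.lift_eq hM x).symm
  have : IsFractionRing V E :=
    IsFractionRing.isFractionRing_of_isDomain_of_isLocalization p.primeCompl V E
  have : IsScalarTower k V E := .of_algebraMap_eq fun r => by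
    rw [IsScalarTower.algebraMap_apply k B V, ← IsScalarTower.algebraMap_apply B V E,
      ← IsScalarTower.algebraMap_apply k B E]
  have : Algebra.EssFiniteType B V := .of_isLocalization V p.primeCompl
  have : Algebra.EssFiniteType k V := .comp k B V
  obtain ⟨D, hD, hDf⟩ := exists_subalgebra_derivation_of_dvr (k := k) (E := E)
    (f := algebraMap B V fB)
    ((map_ne_zero_iff _ (IsLocalization.injective V hle)).mpr hfB0)
    (mem_nonunits_iff.mp <| (IsLocalRing.mem_maximalIdeal _).mp
      ((IsLocalization.AtPrime.to_map_mem_maximal_iff V p fB).mpr hfp))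
  have hfV : algebraMap V E (algebraMap B V fB) = f :=
    (IsScalarTower.algebraMap_apply B V E fB).symm
  refine ⟨(IsScalarTower.toAlgHom k V E).range, D, fun c hc => ?_, ?_, ?_⟩
  · exact ⟨algebraMap B V ⟨c, hCB ⟨c, hc⟩⟩, (IsScalarTower.algebraMap_apply B V E _).symm⟩
  · rintro _ ⟨a, rfl⟩
    obtain ⟨b, hb⟩ := hD a
    exact ⟨b, hb.symm⟩
  · rintro _ ⟨b, rfl⟩ hb
    refine hDf b ?_
    rw [map_mul, hfV]
    exact hb

theorem Derivation.map_aeval_mvPolynomial {k σ E : Type*} [CommRing k] [Fintype σ] [CommRing E]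
    [Algebra k E] (D : Derivation k E E) (x : σ → E) (f : MvPolynomial σ k) :
    D (MvPolynomial.aeval x f) =
      ∑ j, MvPolynomial.aeval x (MvPolynomial.pderiv j f) * D (x j) := by
  classical
  induction f using MvPolynomial.induction_on with
  | C r => simp
  | add p q hp hq => simp [hp, hq, add_mul, Finset.sum_add_distrib]
  | mul_X p i hp =>
    have : ∀ j, MvPolynomial.aeval x (MvPolynomial.pderiv j (p * MvPolynomial.X i)) * D (x j) =
        x i * (MvPolynomial.aeval x (MvPolynomial.pderiv j p) * D (x j)) +
          if j = i then MvPolynomial.aeval x p * D (x i) else 0 := by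
      intro j
      split_ifs with hj
      · subst hj
        simp
        ring
      · simp [MvPolynomial.pderiv_X_of_ne (Ne.symm hj)]
        ring
    rw [Finset.sum_congr rfl fun j _ => this j, Finset.sum_add_distrib, ← Finset.mul_sum, ← hp]
    simp [mul_comm]

/-- The inverse of a polynomial is integral over the algebra generated by the coordinates and
the logarithmic partial derivatives. -/
theorem isIntegral_inv_adjoin_pderiv_div {k σ : Type*} [Field k] [CharZero k] [Finite σ]
    {E : Type*} [Field E] [Algebra (MvPolynomial σ k) E] [IsFractionRing (MvPolynomial σ k) E]
    [Algebra k E] [IsScalarTower k (MvPolynomial σ k) E]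
    {f : MvPolynomial σ k} (hf : f ≠ 0) :
    IsIntegral (Algebra.adjoin k (Set.range (Sum.elim
      (fun j : σ => algebraMap (MvPolynomial σ k) E (MvPolynomial.X j))
      (fun j : σ => algebraMap (MvPolynomial σ k) E (MvPolynomial.pderiv j f) /
        algebraMap (MvPolynomial σ k) E f)))) (algebraMap (MvPolynomial σ k) E f)⁻¹ := by
  have := Fintype.ofFinite σ
  set g : σ ⊕ σ → E := Sum.elim
      (fun j : σ => algebraMap (MvPolynomial σ k) E (MvPolynomial.X j))
      (fun j : σ => algebraMap (MvPolynomial σ k) E (MvPolynomial.pderiv j f) /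
        algebraMap (MvPolynomial σ k) E f) with hg
  let C := Algebra.adjoin k (Set.range g)
  have hgC : ∀ i, g i ∈ C := fun i => Algebra.subset_adjoin ⟨i, rfl⟩
  have haeval : ∀ q : MvPolynomial σ k,
      algebraMap (MvPolynomial σ k) E q = MvPolynomial.aeval (fun j => g (Sum.inl j)) q := by
    intro q
    have : IsScalarTower.toAlgHom k (MvPolynomial σ k) E =
        MvPolynomial.aeval (fun j => g (Sum.inl j)) := by
      ext j; simp [hg]
    exact DFunLike.congr_fun this q
  have hAC : ∀ q : MvPolynomial σ k, algebraMap (MvPolynomial σ k) E q ∈ C := by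
    intro q
    have h1 := MvPolynomial.comp_aeval_apply (fun j => (⟨g (Sum.inl j), hgC _⟩ : C)) C.val q
    rw [haeval]
    exact (show _ = MvPolynomial.aeval (fun j => g (Sum.inl j)) q from h1) ▸ Subtype.prop _
  have : Algebra.FiniteType k C := (Subalgebra.fg_iff_finiteType _).mp
    (Subalgebra.fg_def.mpr ⟨_, Set.finite_range g, rfl⟩)
  let φ : MvPolynomial σ k →+* C := (algebraMap (MvPolynomial σ k) E).codRestrict C hAC
  let _ : Algebra (MvPolynomial σ k) C := φ.toAlgebra
  have : IsScalarTower (MvPolynomial σ k) C E := .of_algebraMap_eq fun _ => rfl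
  have : IsFractionRing C E := IsFractionRing.of_field C E fun z => by
    obtain ⟨a, b, -, rfl⟩ := IsFractionRing.div_surjective (A := MvPolynomial σ k) z
    exact ⟨φ a, φ b, rfl⟩
  by_contra hint
  have hfE : algebraMap (MvPolynomial σ k) E f ≠ 0 := by simpa using hf
  obtain ⟨W, D, hCW, hDW, hD⟩ := exists_subalgebra_derivation C (f := φ f)
    (fun h0 => hfE (congrArg Subtype.val h0)) hint
  refine hD (∑ j, g (Sum.inr j) * D (g (Sum.inl j)))
    (W.sum_mem fun j _ => W.mul_mem (hCW (hgC _)) (hDW _ (hCW (hgC _)))) ?_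
  change D (algebraMap _ E f) = algebraMap _ E f * _
  rw [haeval f, Derivation.map_aeval_mvPolynomial, ← haeval, Finset.mul_sum]
  refine Finset.sum_congr rfl fun j _ => ?_
  rw [← haeval]
  simp only [hg, Sum.elim_inr]
  field_simp

theorem exists_monic_eval_inv_eq_zero {σ : Type*} [Finite σ]
    {f : MvPolynomial σ ℝ} (hf : f ≠ 0) :
    ∃ q : Polynomial (MvPolynomial (σ ⊕ σ) ℝ), q.Monic ∧ ∀ x : σ → ℝ, MvPolynomial.eval x f ≠ 0 →
      q.eval₂ (MvPolynomial.eval (Sum.elim x fun j =>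
        MvPolynomial.eval x (MvPolynomial.pderiv j f) / MvPolynomial.eval x f))
        (MvPolynomial.eval x f)⁻¹ = 0 := by
  let A := MvPolynomial σ ℝ
  let E := FractionRing A
  let g : σ ⊕ σ → E := Sum.elim
      (fun j : σ => algebraMap A E (MvPolynomial.X j))
      (fun j : σ => algebraMap A E (MvPolynomial.pderiv j f) / algebraMap A E f)
  have hint := isIntegral_inv_adjoin_pderiv_div (E := E) hf
  obtain ⟨q, hq, hq0⟩ : ((MvPolynomial.aeval g : _ →ₐ[ℝ] E) : MvPolynomial (σ ⊕ σ) ℝ →+* E).IsIntegralElem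
      (algebraMap A E f)⁻¹ := by
    let C := Algebra.adjoin ℝ (Set.range g)
    let γ : MvPolynomial (σ ⊕ σ) ℝ →ₐ[ℝ] C :=
      MvPolynomial.aeval fun i => ⟨g i, Algebra.subset_adjoin ⟨i, rfl⟩⟩
    have hγ : ((MvPolynomial.aeval g : _ →ₐ[ℝ] E) : MvPolynomial (σ ⊕ σ) ℝ →+* E) =
        (algebraMap C E).comp γ := by
      ext i
      · simp
      · simp [γ]
    have hsurj : Function.Surjective γ := by
      rintro ⟨c, hc⟩
      obtain ⟨r, hr⟩ := (Algebra.adjoin_range_eq_range_aeval ℝ g ▸ hc :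
        c ∈ (MvPolynomial.aeval g : _ →ₐ[ℝ] E).range)
      exact ⟨r, Subtype.ext ((RingHom.congr_fun hγ r).symm.trans hr)⟩
    obtain ⟨p, hp, hp0⟩ := hint
    obtain ⟨q, hqp, -, hq⟩ := Polynomial.lifts_and_natDegree_eq_and_monic
      (f := (γ : MvPolynomial (σ ⊕ σ) ℝ →+* C)) (p := p)
      ((Polynomial.mem_lifts p).mpr (Polynomial.map_surjective _ hsurj p)) hp
    refine ⟨q, hq, ?_⟩
    rw [hγ, ← Polynomial.eval₂_map, hqp]
    exact hp0
  refine ⟨q, hq, fun x hx => ?_⟩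
  let L := Localization.Away f
  let ψ : L →+* ℝ := IsLocalization.Away.lift f (g := MvPolynomial.eval x) hx.isUnit
  have hfE : algebraMap A E f ≠ 0 := by simpa using hf
  let χ : L →+* E := IsLocalization.Away.lift f (g := algebraMap A E) hfE.isUnit
  have hχ : Function.Injective χ := by
    refine (IsLocalization.lift_injective_iff _).mpr fun a b => ?_
    rw [(IsFractionRing.injective A E).eq_iff, (IsLocalization.injective L
      (powers_le_nonZeroDivisors_of_noZeroDivisors hf)).eq_iff]
  have hψA : ∀ a : A, ψ (algebraMap A L a) = MvPolynomial.eval x a :=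
    IsLocalization.Away.lift_eq f hx.isUnit
  have hχA : ∀ a : A, χ (algebraMap A L a) = algebraMap A E a :=
    IsLocalization.Away.lift_eq f hfE.isUnit
  let z : L := IsLocalization.Away.invSelf f
  let gL : σ ⊕ σ → L := Sum.elim (fun j => algebraMap A L (MvPolynomial.X j))
    (fun j => algebraMap A L (MvPolynomial.pderiv j f) * z)
  have hψz : ψ z = (MvPolynomial.eval x f)⁻¹ := by
    refine eq_inv_of_mul_eq_one_right ?_
    rw [← hψA, ← map_mul, IsLocalization.Away.mul_invSelf, map_one]
  have hχz : χ z = (algebraMap A E f)⁻¹ := by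
    refine eq_inv_of_mul_eq_one_right ?_
    rw [← hχA, ← map_mul, IsLocalization.Away.mul_invSelf, map_one]
  let ρ : MvPolynomial (σ ⊕ σ) ℝ →+* L := (MvPolynomial.aeval gL).toRingHom
  have h1 : χ.comp ρ = (MvPolynomial.aeval g : _ →ₐ[ℝ] E) := by
    ext i
    · simp [ρ, IsScalarTower.algebraMap_apply ℝ A L, IsScalarTower.algebraMap_apply ℝ A E, hχA,
        -MvPolynomial.algebraMap_eq]
    · rcases i with i | i
      · simp [ρ, gL, g, hχA]
      · simp [ρ, gL, g, hχA, hχz, div_eq_mul_inv]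
  have h2 : ψ.comp ρ = (MvPolynomial.eval (Sum.elim x fun j =>
        MvPolynomial.eval x (MvPolynomial.pderiv j f) / MvPolynomial.eval x f)) := by
    ext i
    · simp [ρ]
    · rcases i with i | i
      · simp [ρ, gL, hψA]
      · simp [ρ, gL, hψA, hψz, div_eq_mul_inv]
  have h3 : q.eval₂ ρ z = 0 := by
    apply hχ
    rw [Polynomial.hom_eval₂, h1, hχz, hq0, map_zero]
  have h4 := congrArg ψ h3
  rwa [Polynomial.hom_eval₂, h2, hψz, map_zero] at h4

theorem MvPolynomial.exists_abs_eval_le {τ : Type*} [Fintype τ] (Q : MvPolynomial τ ℝ) :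
    ∃ (K : ℝ) (M : ℕ), 0 ≤ K ∧ ∀ y : τ → ℝ, |eval y Q| ≤ K * (1 + ‖y‖) ^ M := by
  induction Q using MvPolynomial.induction_on with
  | C r => exact ⟨|r|, 0, abs_nonneg r, fun y => by simp⟩
  | add p q hp hq =>
    obtain ⟨K, M, hK, h1⟩ := hp
    obtain ⟨K', M', hK', h2⟩ := hq
    refine ⟨K + K', max M M', add_nonneg hK hK', fun y => ?_⟩
    have hy : 1 ≤ 1 + ‖y‖ := by simp
    rw [map_add, add_mul]
    refine (abs_add_le _ _).trans (add_le_add ((h1 y).trans ?_) ((h2 y).trans ?_))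
    · gcongr
      exact le_max_left _ _
    · gcongr
      exact le_max_right _ _
  | mul_X p i hp =>
    obtain ⟨K, M, hK, h1⟩ := hp
    refine ⟨K, M + 1, hK, fun y => ?_⟩
    rw [map_mul, eval_X, abs_mul, pow_succ, ← mul_assoc]
    have : |y i| ≤ 1 + ‖y‖ := (norm_le_pi_norm y i).trans (by simp)
    gcongr
    exact h1 y

theorem abs_le_mul_of_monic_root {R : Type*} [CommRing R] {q : Polynomial R} (hq : q.Monic)
    (φ : R →+* ℝ) {z B : ℝ} (hz : 1 ≤ |z|) (hB : ∀ i, |φ (q.coeff i)| ≤ B)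
    (h0 : q.eval₂ φ z = 0) : |z| ≤ q.natDegree * B := by
  rw [Polynomial.eval₂_eq_sum_range, Finset.sum_range_succ, hq.coeff_natDegree, map_one,
    one_mul] at h0
  rcases hm : q.natDegree with _ | m
  · simp [hm] at h0
  rw [hm] at h0
  have h1 : |z| ^ (m + 1) ≤ ((m + 1 : ℕ) * B) * |z| ^ m := by
    rw [← abs_pow, eq_neg_of_add_eq_zero_right h0, abs_neg]
    refine (Finset.abs_sum_le_sum_abs _ _).trans ?_
    have : ∀ i ∈ Finset.range (m + 1), |φ (q.coeff i) * z ^ i| ≤ B * |z| ^ m := fun i hi => by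
      rw [abs_mul, abs_pow]
      have hB0 : 0 ≤ B := (abs_nonneg _).trans (hB 0)
      gcongr
      · exact hB i
      · exact Nat.lt_succ_iff.mp (Finset.mem_range.mp hi)
    refine (Finset.sum_le_sum this).trans_eq ?_
    simp
    ring
  rw [pow_succ'] at h1
  exact le_of_mul_le_mul_right h1 (by positivity)

open Filter Topology in
/-- **Łojasiewicz gradient inequality** for polynomials. -/
theorem MvPolynomial.exists_lojasiewicz {σ : Type*} [Fintype σ] (P : MvPolynomial σ ℝ)
    (θ : σ → ℝ) : ∃ c A : ℝ, 0 < c ∧ A ∈ Set.Ioo (0 : ℝ) 1 ∧ ∀ᶠ x in 𝓝 θ, ∀ e, A ≤ e →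
      |eval x P - eval θ P| ^ e ≤ c * ‖fun j => eval x (pderiv j P)‖ := by
  set f : MvPolynomial σ ℝ := P - C (eval θ P) with hf
  have hfe : ∀ x, eval x P - eval θ P = eval x f := fun x => by simp [hf]
  have hfd : ∀ j, pderiv j P = pderiv j f := fun j => by simp [hf]
  simp only [hfe, hfd]
  have hzero : ∀ x, eval x f = 0 → ∀ (c A : ℝ), 0 < c → 0 < A → ∀ e, A ≤ e →
      |eval x f| ^ e ≤ c * ‖fun j => eval x (pderiv j f)‖ := by
    intro x hx c A hc hA e he
    rw [hx, abs_zero, Real.zero_rpow (hA.trans_le he).ne']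
    positivity
  by_cases hf0 : f = 0
  · exact ⟨1, 1 / 2, one_pos, by norm_num, .of_forall fun x =>
      hzero x (by simp [hf0]) _ _ one_pos (by norm_num)⟩
  obtain ⟨q, hq, hroot⟩ := exists_monic_eval_inv_eq_zero hf0
  choose K M hK hKM using fun i => (q.coeff i).exists_abs_eval_le
  let K' : ℝ := ∑ i ∈ Finset.range (q.natDegree + 1), K i
  let M' : ℕ := ∑ i ∈ Finset.range (q.natDegree + 1), M i + 2
  let L : ℝ := q.natDegree * K' + 1
  have hK' : 0 ≤ K' := Finset.sum_nonneg fun i _ => hK i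
  have hL : 1 ≤ L := le_add_of_nonneg_left (by positivity)
  have hcoeff : ∀ (y : σ ⊕ σ → ℝ) i, |eval y (q.coeff i)| ≤ K' * (1 + ‖y‖) ^ M' := by
    intro y i
    have hy : 1 ≤ 1 + ‖y‖ := by simp
    by_cases hi : i ∈ Finset.range (q.natDegree + 1)
    · refine (hKM i y).trans ?_
      gcongr
      · exact Finset.single_le_sum (fun i _ => hK i) hi
      · exact (Finset.single_le_sum (fun i _ => (M i).zero_le) hi).trans (Nat.le_add_right _ _)
    · rw [Polynomial.coeff_eq_zero_of_natDegree_lt (by simpa using hi)]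
      simp only [map_zero, abs_zero]
      positivity
  have hM2 : (2 : ℝ) ≤ M' := by
    have : 2 ≤ M' := Nat.le_add_left _ _
    exact_mod_cast this
  let B : ℝ := 2 + ‖θ‖
  have hcont : ContinuousAt (fun x => |eval x f| ^ (M' : ℝ)⁻¹) θ :=
    ((MvPolynomial.continuous_eval f).abs.continuousAt).rpow_const (Or.inr (by positivity))
  have hev1 : ∀ᶠ x in 𝓝 θ, |eval x f| ^ (M' : ℝ)⁻¹ < 1 / (2 * (L * B)) := by
    refine hcont.eventually_lt_const ?_
    have : eval θ f = 0 := by simp [hf]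
    beta_reduce
    rw [this, abs_zero, Real.zero_rpow (by positivity)]
    positivity
  have hev2 : ∀ᶠ x in 𝓝 θ, |eval x f| < 1 := by
    refine (MvPolynomial.continuous_eval f).abs.continuousAt.eventually_lt_const ?_
    simp [hf]
  have hev3 : ∀ᶠ x in 𝓝 θ, ‖x‖ < ‖θ‖ + 1 :=
    continuous_norm.continuousAt.eventually_lt_const (by simp)
  have hA0 : 0 < 1 - (M' : ℝ)⁻¹ := sub_pos.mpr (inv_lt_one_of_one_lt₀ (by linarith))
  refine ⟨2 * L, 1 - (M' : ℝ)⁻¹, by positivity, ⟨hA0, sub_lt_self _ (by positivity)⟩, ?_⟩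
  filter_upwards [hev1, hev2, hev3] with x h1 h2 h3
  by_cases hx : eval x f = 0
  · exact hzero x hx _ (1 - (M' : ℝ)⁻¹) (by positivity) hA0
  intro e he
  have hs : 0 < |eval x f| := abs_pos.mpr hx
  refine (Real.rpow_le_rpow_of_exponent_ge hs h2.le he).trans ?_
  set s := |eval x f| with hsdef
  set r := s ^ (M' : ℝ)⁻¹ with hr
  set g := ‖fun j => eval x (pderiv j f)‖ with hg
  have hr0 : 0 < r := Real.rpow_pos_of_pos hs _
  have hrM : r ^ M' = s := Real.rpow_inv_natCast_pow hs.le (by omega)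
  rw [Real.rpow_sub hs, Real.rpow_one, ← hr]
  set y : σ ⊕ σ → ℝ := Sum.elim x fun j => eval x (pderiv j f) / eval x f with hy
  have hyB : 1 + ‖y‖ ≤ B + g / s := by
    have : ‖y‖ ≤ (‖θ‖ + 1) + g / s := by
      refine (pi_norm_le_iff_of_nonneg (by positivity)).mpr ?_
      rintro (j | j)
      · exact ((norm_le_pi_norm x j).trans h3.le).trans (le_add_of_nonneg_right (by positivity))
      · simp only [hy, Sum.elim_inr, norm_div]
        rw [Real.norm_eq_abs (eval x f), ← hsdef]
        refine le_trans ?_ (le_add_of_nonneg_left (by positivity))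
        gcongr
        exact norm_le_pi_norm (fun j => eval x (pderiv j f)) j
    simp only [B]
    linarith
  have hz := abs_le_mul_of_monic_root hq (eval y) (z := (eval x f)⁻¹)
    (by rw [abs_inv]; exact (one_le_inv₀ hs).mpr h2.le) (hcoeff y) (hroot x hx)
  rw [abs_inv, ← hsdef] at hz
  have key : 1 ≤ (L * (r * (B + g / s))) ^ M' := by
    have hstep : s⁻¹ ≤ L * (B + g / s) ^ M' := by
      refine hz.trans ?_
      rw [← mul_assoc]
      gcongr
      exact le_add_of_nonneg_right zero_le_one
    rw [mul_pow, mul_pow, hrM]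
    calc (1 : ℝ) = s * s⁻¹ := (mul_inv_cancel₀ hs.ne').symm
      _ ≤ s * (L * (B + g / s) ^ M') := by gcongr
      _ = L * (s * (B + g / s) ^ M') := by ring
      _ ≤ L ^ M' * (s * (B + g / s) ^ M') := by
        gcongr
        exact le_self_pow₀ hL (by omega)
  have key2 : 1 ≤ L * (r * (B + g / s)) := by
    by_contra! hlt
    exact absurd key (not_le.mpr (pow_lt_one₀ (by positivity) hlt (by omega)))
  have h4 : L * B * r ≤ 1 / 2 := by
    rw [lt_div_iff₀ (by positivity)] at h1
    linarith
  have h5 : 1 / 2 ≤ L * (r * (g / s)) := by linarith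
  rw [div_le_iff₀ hr0]
  have h6 : L * (r * (g / s)) * s = L * r * g := by field_simp
  nlinarith

/-- `F` is a continuous selection of finitely many elements of `R`. -/
def IsFinSelection {X : Type*} [TopologicalSpace X] (R : Subalgebra ℝ (X → ℝ)) (F : X → ℝ) :
    Prop :=
  Continuous F ∧ ∃ S : Set (X → ℝ), S.Finite ∧ S ⊆ R ∧ ∀ x, ∃ P ∈ S, F x = P x

namespace IsFinSelection

variable {X : Type*} [TopologicalSpace X] {R : Subalgebra ℝ (X → ℝ)} {F G : X → ℝ}

theorem of_mem (hF : Continuous F) (h : F ∈ R) : IsFinSelection R F :=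
  ⟨hF, {F}, Set.finite_singleton F, by simpa using h, fun _ => ⟨F, rfl, rfl⟩⟩

theorem const (r : ℝ) : IsFinSelection R fun _ => r :=
  of_mem continuous_const (R.algebraMap_mem r)

theorem add (hF : IsFinSelection R F) (hG : IsFinSelection R G) :
    IsFinSelection R fun x => F x + G x := by
  obtain ⟨hF, S, hS, hSR, h⟩ := hF
  obtain ⟨hG, T, hT, hTR, h'⟩ := hG
  refine ⟨hF.add hG, Set.image2 (· + ·) S T, hS.image2 _ hT,
    Set.image2_subset_iff.mpr fun P hP Q hQ => R.add_mem (hSR hP) (hTR hQ), fun x => ?_⟩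
  obtain ⟨P, hP, hx⟩ := h x
  obtain ⟨Q, hQ, hx'⟩ := h' x
  exact ⟨P + Q, ⟨P, hP, Q, hQ, rfl⟩, by simp [hx, hx']⟩

theorem mul (hF : IsFinSelection R F) (hG : IsFinSelection R G) :
    IsFinSelection R fun x => F x * G x := by
  obtain ⟨hF, S, hS, hSR, h⟩ := hF
  obtain ⟨hG, T, hT, hTR, h'⟩ := hG
  refine ⟨hF.mul hG, Set.image2 (· * ·) S T, hS.image2 _ hT,
    Set.image2_subset_iff.mpr fun P hP Q hQ => R.mul_mem (hSR hP) (hTR hQ), fun x => ?_⟩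
  obtain ⟨P, hP, hx⟩ := h x
  obtain ⟨Q, hQ, hx'⟩ := h' x
  exact ⟨P * Q, ⟨P, hP, Q, hQ, rfl⟩, by simp [hx, hx']⟩

theorem const_mul (r : ℝ) (hF : IsFinSelection R F) : IsFinSelection R fun x => r * F x :=
  (const r).mul hF

theorem of_eq_or_eq {H : X → ℝ} (hH : Continuous H) (hF : IsFinSelection R F)
    (hG : IsFinSelection R G) (h : ∀ x, H x = F x ∨ H x = G x) : IsFinSelection R H := by
  obtain ⟨-, S, hS, hSR, hF⟩ := hF
  obtain ⟨-, T, hT, hTR, hG⟩ := hG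
  refine ⟨hH, S ∪ T, hS.union hT, Set.union_subset hSR hTR, fun x => ?_⟩
  rcases h x with h | h
  · obtain ⟨P, hP, hx⟩ := hF x
    exact ⟨P, Or.inl hP, h.trans hx⟩
  · obtain ⟨P, hP, hx⟩ := hG x
    exact ⟨P, Or.inr hP, h.trans hx⟩

theorem max (hF : IsFinSelection R F) (hG : IsFinSelection R G) :
    IsFinSelection R fun x => F x ⊔ G x :=
  hF.of_eq_or_eq (hF.1.max hG.1) hG fun x => max_choice (F x) (G x)

theorem min (hF : IsFinSelection R F) (hG : IsFinSelection R G) :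
    IsFinSelection R fun x => F x ⊓ G x :=
  hF.of_eq_or_eq (hF.1.min hG.1) hG fun x => min_choice (F x) (G x)

end IsFinSelection

/-- The algebra of polynomial functions in one variable. -/
abbrev polyFun : Subalgebra ℝ (ℝ → ℝ) := (Polynomial.aeval (id : ℝ → ℝ)).range

/-- The algebra of polynomial functions in several variables. -/
abbrev mvPolyFun (σ : Type*) : Subalgebra ℝ ((σ → ℝ) → ℝ) :=
  (MvPolynomial.aeval fun (i : σ) (x : σ → ℝ) => x i).range

theorem Polynomial.aeval_id_apply (q : Polynomial ℝ) (x : ℝ) :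
    aeval (id : ℝ → ℝ) q x = q.eval x := by
  have := (aeval_algHom_apply (Pi.evalAlgHom ℝ (fun _ : ℝ => ℝ) x) (id : ℝ → ℝ) q).symm
  simpa only [Pi.evalAlgHom_apply, id_eq, coe_aeval_eq_eval] using this

theorem MvPolynomial.aeval_proj_apply {σ : Type*} (q : MvPolynomial σ ℝ) (x : σ → ℝ) :
    aeval (fun (i : σ) (x : σ → ℝ) => x i) q x = eval x q := by
  induction q using MvPolynomial.induction_on with
  | C r => simp
  | add p q hp hq => simp [hp, hq]
  | mul_X p i hp => simp [hp]

theorem IsFinSelection.comp {X : Type*} [TopologicalSpace X] {R : Subalgebra ℝ (X → ℝ)}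
    {u : X → ℝ} {g : ℝ → ℝ} (hg : IsFinSelection polyFun g) (hu : IsFinSelection R u) :
    IsFinSelection R fun x => g (u x) := by
  obtain ⟨hg, S, hS, hSR, h⟩ := hg
  obtain ⟨hu, T, hT, hTR, h'⟩ := hu
  refine ⟨hg.comp hu, Set.image2 (· ∘ ·) S T, hS.image2 _ hT,
    Set.image2_subset_iff.mpr fun P hP Q hQ => ?_, fun x => ?_⟩
  · obtain ⟨q, rfl⟩ := hSR hP
    have : (Polynomial.aeval (id : ℝ → ℝ) q) ∘ Q = Polynomial.aeval Q q := by
      ext x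
      have := Polynomial.aeval_algHom_apply (Pi.evalAlgHom ℝ (fun _ : X => ℝ) x) Q q
      simp only [Pi.evalAlgHom_apply] at this
      simp [← this]
    show (Polynomial.aeval (id : ℝ → ℝ) q) ∘ Q ∈ R
    rw [this]
    exact Algebra.adjoin_le (Set.singleton_subset_iff.mpr (hTR hQ))
      (Polynomial.aeval_mem_adjoin_singleton ℝ Q)
  · obtain ⟨P, hP, hx⟩ := h' x
    obtain ⟨Q, hQ, hx'⟩ := h (u x)
    exact ⟨Q ∘ P, ⟨Q, hQ, P, hP, rfl⟩, by simp [hx', ← hx]⟩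

theorem PiecewisePoly.isFinSelection {F : ℝ → ℝ} (hF : Continuous F) (h : PiecewisePoly F) :
    IsFinSelection polyFun F := by
  obtain ⟨K, τ, -, h0, hK, -, hq⟩ := h
  choose q hq using fun k : Fin K => hq k k.2
  refine ⟨hF, Set.range (fun k => Polynomial.aeval id (q k)) ∪
    (fun k => fun _ => F (τ k).toReal) '' Set.Iio K, (Set.finite_range _).union
      ((Set.finite_Iio K).image _), ?_, fun x => ?_⟩
  · rintro _ (⟨k, rfl⟩ | ⟨k, -, rfl⟩)
    · exact ⟨q k, rfl⟩
    · exact polyFun.algebraMap_mem _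
  · have hex : ∃ n, (x : EReal) < τ n := ⟨K, hK ▸ EReal.coe_lt_top x⟩
    classical
    obtain ⟨k, hk⟩ : ∃ k, Nat.find hex = k + 1 := by
      refine Nat.exists_eq_succ_of_ne_zero fun h => ?_
      have := Nat.find_spec hex
      rw [h, h0] at this
      exact not_lt_bot this
    have hx := Nat.find_spec hex
    have hx' : ¬ (x : EReal) < τ k := Nat.find_min hex (by omega)
    have hkK : Nat.find hex ≤ K := Nat.find_min' hex (hK ▸ EReal.coe_lt_top x)
    rw [hk] at hx hkK
    rcases (not_lt.mp hx').eq_or_lt with h | h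
    · exact ⟨_, Or.inr ⟨k, hkK, rfl⟩, by simp [h]⟩
    · exact ⟨_, Or.inl ⟨⟨k, hkK⟩, rfl⟩, by
        exact (hq ⟨k, hkK⟩ x h hx).trans (Polynomial.aeval_id_apply _ _).symm⟩

theorem Polynomial.exists_integral_eq (P : Polynomial ℝ) :
    ∃ Q : Polynomial ℝ, ∀ x y, ∫ t in x..y, P.eval t = Q.eval y - Q.eval x := by
  obtain ⟨Q, hQ⟩ : ∃ Q : Polynomial ℝ, derivative Q = P := by
    induction P using Polynomial.induction_on' with
    | add p q hp hq =>
      obtain ⟨Q, rfl⟩ := hp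
      obtain ⟨Q', rfl⟩ := hq
      exact ⟨Q + Q', by simp⟩
    | monomial n r =>
      refine ⟨monomial (n + 1) (r / (n + 1)), ?_⟩
      rw [derivative_monomial]
      congr 1
      push_cast
      field_simp
  refine ⟨Q, fun x y => ?_⟩
  subst hQ
  exact intervalIntegral.integral_eq_sub_of_hasDerivAt (fun t _ => Q.hasDerivAt t)
    ((Polynomial.continuous _).intervalIntegrable _ _)

theorem IsFinSelection.integral {g : ℝ → ℝ} (hg : IsFinSelection polyFun g) (a : ℝ) :
    IsFinSelection polyFun fun u => ∫ x in a..u, g x := by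
  obtain ⟨hg, S, hS, hSR, h⟩ := hg
  have hint : ∀ x y, IntervalIntegrable g volume x y := fun x y => hg.intervalIntegrable x y
  have hcont : Continuous fun u => ∫ x in a..u, g x :=
    intervalIntegral.continuous_primitive hint a
  have hpoly : ∀ P ∈ S, ∃ q : Polynomial ℝ, P = fun x => q.eval x := fun P hP => by
    obtain ⟨q, rfl⟩ := hSR hP
    exact ⟨q, funext q.aeval_id_apply⟩
  have hScont : ∀ P ∈ S, Continuous P := fun P hP => by
    obtain ⟨q, rfl⟩ := hpoly P hP
    exact q.continuous
  let B : Set ℝ := ⋃ P ∈ S, ⋃ Q ∈ S, {x | P ≠ Q ∧ P x = Q x}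
  have hB : B.Finite := by
    refine hS.biUnion fun P hP => hS.biUnion fun Q hQ => ?_
    obtain ⟨p, rfl⟩ := hpoly P hP
    obtain ⟨q, rfl⟩ := hpoly Q hQ
    by_cases hpq : p = q
    · simp [hpq]
    · refine (p - q).rootSet_finite ℝ |>.subset fun x hx => ?_
      rw [Polynomial.mem_rootSet]
      exact ⟨sub_ne_zero.mpr hpq, by simpa [sub_eq_zero] using hx.2⟩
  have hBmem : ∀ {x P Q}, x ∉ B → P ∈ S → Q ∈ S → P x = Q x → P = Q := by
    intro x P Q hx hP hQ hPQ
    by_contra hne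
    exact hx (Set.mem_biUnion hP (Set.mem_biUnion hQ ⟨hne, hPQ⟩))
  have heq : ∀ x y, x ≤ y → Disjoint (Set.Icc x y) B → ∀ P ∈ S, g x = P x →
      ∀ z ∈ Set.Icc x y, g z = P z := by
    intro x y hxy hdisj P hP hx z hz
    by_contra hne
    obtain ⟨w, hw, hw1, hw2⟩ := isPreconnected_closed_iff.mp (isPreconnected_Icc (a := x) (b := y))
      {z | g z = P z} (⋃ Q ∈ S \ {P}, {z | g z = Q z})
      (isClosed_eq hg (hScont P hP))
      ((hS.subset Set.sdiff_subset).isClosed_biUnion fun Q hQ => isClosed_eq hg (hScont Q hQ.1))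
      (fun t _ => by
        obtain ⟨Q, hQ, ht⟩ := h t
        by_cases hQP : Q = P
        · exact Or.inl (hQP ▸ ht)
        · exact Or.inr (Set.mem_biUnion ⟨hQ, hQP⟩ ht))
      ⟨x, Set.left_mem_Icc.mpr hxy, hx⟩
      ⟨z, hz, by
        obtain ⟨Q, hQ, ht⟩ := h z
        refine Set.mem_biUnion ⟨hQ, fun hQP => hne ?_⟩ ht
        rw [← Set.mem_singleton_iff.mp hQP]
        exact ht⟩
    simp only [Set.mem_iUnion] at hw2
    obtain ⟨Q, hQ, hwQ⟩ := hw2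
    exact hQ.2 (hBmem (Set.disjoint_left.mp hdisj hw) hP hQ.1 (hw1.symm.trans hwQ)).symm
  choose! q hq using hpoly
  choose Q hQ using fun P => (q P).exists_integral_eq
  choose P hPS hP using h
  let R : ℝ → ℝ → ℝ := fun x u => (Q (P x)).eval u + ((∫ t in a..x, g t) - (Q (P x)).eval x)
  have hR : ∀ x y, x ≤ y → Disjoint (Set.Icc x y) B → R x = R y := by
    intro x y hxy hdisj
    have hgz := heq x y hxy hdisj (P x) (hPS x) (hP x)
    have hPxy : P x = P y := hBmem (Set.disjoint_left.mp hdisj (Set.right_mem_Icc.mpr hxy))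
      (hPS x) (hPS y) ((hgz y (Set.right_mem_Icc.mpr hxy)).symm.trans (hP y))
    have : ∫ t in x..y, g t = (Q (P x)).eval y - (Q (P x)).eval x := by
      rw [← hQ]
      refine intervalIntegral.integral_congr fun t ht => ?_
      rw [Set.uIcc_of_le hxy] at ht
      exact (hgz t ht).trans (congrFun (hq _ (hPS x)) t)
    have hadd := intervalIntegral.integral_add_adjacent_intervals (hint a x) (hint x y)
    ext u
    simp only [R, ← hPxy]
    linarith
  have hfac : (fun x : (Bᶜ : Set ℝ) => R x).FactorsThrough fun x => B ∩ Set.Iio (x : ℝ) := by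
    have key : ∀ x y : (Bᶜ : Set ℝ), (x : ℝ) ≤ y → B ∩ Set.Iio (x : ℝ) = B ∩ Set.Iio (y : ℝ) →
        R x = R y := by
      intro x y hxy hT
      refine hR _ _ hxy (Set.disjoint_left.mpr fun z hz hzB => ?_)
      have hzy : z < y := lt_of_le_of_ne hz.2 fun h => y.2 (h ▸ hzB)
      have : z ∈ B ∩ Set.Iio (x : ℝ) := hT ▸ ⟨hzB, hzy⟩
      exact absurd this.2 (not_lt.mpr hz.1)
    intro x y hT
    rcases le_total (x : ℝ) y with hxy | hxy
    · exact key x y hxy hT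
    · exact (key y x hxy hT.symm).symm
  obtain ⟨k, hk⟩ := (Function.factorsThrough_iff _).mp hfac
  refine ⟨hcont, R '' Bᶜ ∪ (fun b => fun _ => ∫ t in a..b, g t) '' B, Set.Finite.union ?_
    (hB.image _), ?_, fun x => ?_⟩
  · refine (hB.finite_subsets.image k).subset ?_
    rintro _ ⟨x, hx, rfl⟩
    exact ⟨B ∩ Set.Iio x, Set.inter_subset_left, (congrFun hk ⟨x, hx⟩).symm⟩
  · rintro _ (⟨x, -, rfl⟩ | ⟨x, -, rfl⟩)
    · exact ⟨Q (P x) + Polynomial.C ((∫ t in a..x, g t) - (Q (P x)).eval x), by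
        ext u
        refine (Polynomial.aeval_id_apply _ _).trans ?_
        simp [R]⟩
    · exact polyFun.algebraMap_mem _
  · by_cases hx : x ∈ B
    · exact ⟨_, Or.inr ⟨x, hx, rfl⟩, rfl⟩
    · exact ⟨_, Or.inl ⟨x, hx, rfl⟩, by simp [R]⟩

/-- Functions of `(θ, x)` which for `x ∈ (a, b)` have the form `α θ * g x * 𝟙 {x > u θ}`. -/
def stepTerms (σ : Type*) (a b : ℝ) : Submonoid ((σ → ℝ) → ℝ → ℝ) where
  carrier := {Φ | ∃ (α u : (σ → ℝ) → ℝ) (g : ℝ → ℝ), IsFinSelection (mvPolyFun σ) α ∧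
    IsFinSelection (mvPolyFun σ) u ∧ IsFinSelection polyFun g ∧
    ∀ θ, ∀ x ∈ Set.Ioo a b, Φ θ x = α θ * (Set.Ioi (u θ)).indicator g x}
  one_mem' := ⟨_, _, _, .const 1, .const a, .const 1, fun θ x hx => by
    simp [Set.indicator, hx.1]⟩
  mul_mem' := by
    rintro Φ Ψ ⟨α, u, g, hα, hu, hg, h⟩ ⟨α', u', g', hα', hu', hg', h'⟩
    refine ⟨_, _, _, hα.mul hα', hu.max hu', hg.mul hg', fun θ x hx => ?_⟩
    simp only [Pi.mul_apply, h θ x hx, h' θ x hx, Set.indicator, Set.mem_Ioi, sup_lt_iff]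
    split_ifs <;> simp_all
    ring

theorem setIntegral_Ioo_indicator_Ioi {g : ℝ → ℝ} (hg : Continuous g) {a b : ℝ} (hab : a ≤ b)
    (u : ℝ) : ∫ x in Set.Ioo a b, (Set.Ioi u).indicator g x =
      (∫ x in a..b, g x) - ∫ x in a..(a ⊔ u ⊓ b), g x := by
  rw [intervalIntegral.integral_interval_sub_left (hg.intervalIntegrable _ _)
    (hg.intervalIntegrable _ _), intervalIntegral.integral_of_le (sup_le hab inf_le_right),
    ← integral_Ioc_eq_integral_Ioo, setIntegral_indicator measurableSet_Ioi]
  congr 2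
  ext x
  simp only [Set.mem_inter_iff, Set.mem_Ioc, Set.mem_Ioi, sup_lt_iff, inf_lt_iff]
  grind

theorem isFinSelection_integral_of_mem_adjoin {σ : Type*} {a b : ℝ} (hab : a ≤ b)
    {Φ : (σ → ℝ) → ℝ → ℝ} (hΦ : Φ ∈ Algebra.adjoin ℝ (stepTerms σ a b : Set _)) :
    IsFinSelection (mvPolyFun σ) fun θ => ∫ x in Set.Ioo a b, Φ θ x := by
  rw [← Subalgebra.mem_toSubmodule, Algebra.adjoin_eq_span, Submonoid.closure_eq] at hΦ
  suffices (∀ θ, IntegrableOn (Φ θ) (Set.Ioo a b)) ∧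
    IsFinSelection (mvPolyFun σ) fun θ => ∫ x in Set.Ioo a b, Φ θ x from this.2
  induction hΦ using Submodule.span_induction with
  | zero => exact ⟨fun θ => integrableOn_zero, by simpa using .const 0⟩
  | add Φ Ψ _ _ h h' =>
    refine ⟨fun θ => (h.1 θ).add (h'.1 θ), ?_⟩
    convert h.2.add h'.2 using 2 with θ
    exact integral_add (h.1 θ) (h'.1 θ)
  | smul r Φ _ h =>
    refine ⟨fun θ => (h.1 θ).smul r, ?_⟩
    convert h.2.const_mul r using 2 with θ
    exact integral_const_mul r _
  | mem Φ hΦ =>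
    obtain ⟨α, u, g, hα, hu, hg, h⟩ := hΦ
    constructor
    · intro θ
      refine IntegrableOn.congr_fun ?_ (fun x hx => (h θ x hx).symm) measurableSet_Ioo
      refine Integrable.const_mul (Integrable.indicator ?_ measurableSet_Ioi) _
      exact (hg.1.integrableOn_Icc (a := a) (b := b)).mono_set Set.Ioo_subset_Icc_self
    · have hsel := hα.mul ((IsFinSelection.const (∫ x in a..b, g x)).add
        (((hg.integral a).comp ((IsFinSelection.const a).max (hu.min (.const b)))).const_mul (-1)))
      convert hsel using 2 with θ
      rw [setIntegral_congr_fun measurableSet_Ioo (h θ), integral_const_mul,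
        setIntegral_Ioo_indicator_Ioi hg.1 hab]
      ring

theorem clipFn_affine_eq {w : ℝ} (hw : 0 < w) (s x : ℝ) :
    clipFn (w * x + s) =
      w * (Set.Ioi (-w⁻¹ * s)).indicator id x + s * (Set.Ioi (-w⁻¹ * s)).indicator 1 x -
      (w * (Set.Ioi (-w⁻¹ * (s + -1))).indicator id x +
        (s + -1) * (Set.Ioi (-w⁻¹ * (s + -1))).indicator 1 x) := by
  have key : ∀ t, w * (Set.Ioi (-w⁻¹ * t)).indicator id x +
      t * (Set.Ioi (-w⁻¹ * t)).indicator 1 x = (w * x + t) ⊔ 0 := by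
    intro t
    have : -w⁻¹ * t < x ↔ 0 < w * x + t := by
      rw [neg_mul, neg_lt, ← div_eq_inv_mul, lt_div_iff₀ hw]
      constructor <;> intro h <;> linarith
    simp only [Set.indicator, Set.mem_Ioi, this]
    by_cases ht : 0 < w * x + t
    · simp [ht, ht.le]
    · simp [ht, not_lt.mp ht]
  rw [key, key, clipFn]
  grind

theorem riskC_isFinSelection {a b : ℝ} (hab : a ≤ b) {h : ℕ} {v w : Fin h → ℝ}
    (hw : ∀ i, 0 < w i) {f p : ℝ → ℝ} (hf : IsFinSelection polyFun f)
    (hp : IsFinSelection polyFun p) :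
    IsFinSelection (mvPolyFun (Fin (h + 1))) (riskC a b v w f p) := by
  let A := Algebra.adjoin ℝ (stepTerms (Fin (h + 1)) a b : Set ((Fin (h + 1) → ℝ) → ℝ → ℝ))
  have hterm : ∀ {α u : (Fin (h + 1) → ℝ) → ℝ} {g : ℝ → ℝ},
      IsFinSelection (mvPolyFun (Fin (h + 1))) α → IsFinSelection (mvPolyFun (Fin (h + 1))) u →
      IsFinSelection polyFun g → (fun θ x => α θ * (Set.Ioi (u θ)).indicator g x) ∈ A :=
    fun hα hu hg => Algebra.subset_adjoin ⟨_, _, _, hα, hu, hg, fun _ _ _ => rfl⟩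
  have hfun : ∀ {g : ℝ → ℝ}, IsFinSelection polyFun g →
      (fun (_ : Fin (h + 1) → ℝ) x => g x) ∈ A := fun hg =>
    Algebra.subset_adjoin ⟨_, _, _, .const 1, .const a, hg, fun θ x hx => by
      simp [Set.indicator, hx.1]⟩
  have hproj : ∀ i, IsFinSelection (mvPolyFun (Fin (h + 1))) fun θ => θ i := fun i =>
    .of_mem (continuous_apply i) ⟨MvPolynomial.X i, MvPolynomial.aeval_X _ i⟩
  have hid : IsFinSelection polyFun id :=
    .of_mem continuous_id ⟨Polynomial.X, Polynomial.aeval_X _⟩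
  have hone : IsFinSelection polyFun 1 := .const 1
  have hlast : (fun (θ : Fin (h + 1) → ℝ) (_ : ℝ) => θ (Fin.last h)) ∈ A :=
    Algebra.subset_adjoin ⟨_, _, _, hproj (Fin.last h), .const a, .const 1, fun θ x hx => by
      simp [Set.indicator, hx.1]⟩
  have hclip : ∀ i : Fin h,
      (fun (θ : Fin (h + 1) → ℝ) x => clipFn (w i * x + θ i.castSucc)) ∈ A := by
    intro i
    simp only [clipFn_affine_eq (hw i)]
    have hrelu : ∀ {s : (Fin (h + 1) → ℝ) → ℝ}, IsFinSelection (mvPolyFun (Fin (h + 1))) s →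
        (fun θ x => w i * (Set.Ioi (-(w i)⁻¹ * s θ)).indicator id x +
          s θ * (Set.Ioi (-(w i)⁻¹ * s θ)).indicator 1 x) ∈ A := fun hs =>
      A.add_mem (hterm (.const (w i)) (hs.const_mul _) hid) (hterm hs (hs.const_mul _) hone)
    exact A.sub_mem (hrelu (hproj _)) (hrelu ((hproj _).add (.const (-1))))
  have hreal : (fun θ x => realC v w θ x) ∈ A := by
    have := A.add_mem hlast (A.sum_mem (t := Finset.univ) fun i _ =>
      A.smul_mem (hclip i) (v i))
    convert this using 1
    ext θ x
    simp [realC]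
  exact isFinSelection_integral_of_mem_adjoin hab
    (A.mul_mem (A.pow_mem (A.sub_mem hreal (hfun hf)) 2) (hfun hp))

theorem MvPolynomial.dense_eval_ne_zero {σ : Type*} [Finite σ] {P : MvPolynomial σ ℝ}
    (hP : P ≠ 0) : Dense {x : σ → ℝ | eval x P ≠ 0} := by
  have := Fintype.ofFinite σ
  refine Metric.dense_iff.mpr fun x r hr => ?_
  by_contra hempty
  refine hP (funext_set (fun i => Metric.ball (x i) r)
    (fun i => (Real.ball_eq_Ioo _ _ ▸ Set.Ioo_infinite (by linarith))) fun y hy => ?_)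
  rw [← ball_pi _ hr] at hy
  by_contra hne
  exact hempty ⟨y, hy, by simpa using hne⟩

theorem MvPolynomial.contDiff_eval {σ : Type*} [Fintype σ] (P : MvPolynomial σ ℝ) {n} :
    ContDiff ℝ n fun x => eval x P := by
  induction P using MvPolynomial.induction_on with
  | C r => simpa using contDiff_const
  | add p q hp hq => simpa using hp.add hq
  | mul_X p i hp => simpa using hp.mul (contDiff_apply ℝ ℝ i)

theorem MvPolynomial.fderiv_eval_single {σ : Type*} [Fintype σ] [DecidableEq σ]
    (P : MvPolynomial σ ℝ) (x : σ → ℝ) (j : σ) :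
    fderiv ℝ (fun x => eval x P) x (Pi.single j 1) = eval x (pderiv j P) := by
  have hd : ∀ P : MvPolynomial σ ℝ, DifferentiableAt ℝ (fun x => eval x P) x := fun P =>
    P.contDiff_eval (n := 1) |>.differentiable one_ne_zero x
  induction P using MvPolynomial.induction_on with
  | C r => simp
  | add p q hp hq => simp [fderiv_fun_add (hd p) (hd q), hp, hq]
  | mul_X p i hp =>
    have hX : HasFDerivAt (fun x : σ → ℝ => x i) (ContinuousLinearMap.proj i) x :=
      hasFDerivAt_apply (𝕜 := ℝ) i x
    simp only [map_mul, eval_X, ((hd p).hasFDerivAt.fun_mul hX).fderiv]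
    by_cases hij : i = j
    · simp [hp, Derivation.leibniz, hij]
    · simp [hp, Derivation.leibniz, pderiv_X_of_ne hij, Pi.single_eq_of_ne hij]

open Topology in
/-- The Łojasiewicz gradient inequality for a continuously differentiable function which is a
continuous selection of finitely many polynomials. -/
theorem IsFinSelection.exists_lojasiewicz {σ : Type*} [Fintype σ] [DecidableEq σ]
    {F : (σ → ℝ) → ℝ} (hF : IsFinSelection (mvPolyFun σ) F) (hd : ContDiff ℝ 1 F)
    (θ : σ → ℝ) : ∃ c A : ℝ, 0 < c ∧ A ∈ Set.Ioo (0 : ℝ) 1 ∧ ∀ᶠ x in 𝓝 θ, ∀ e, A ≤ e →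
      |F x - F θ| ^ e ≤ c * ‖fun j => fderiv ℝ F x (Pi.single j 1)‖ := by
  obtain ⟨hFc, S, hS, hSR, hsel⟩ := hF
  obtain ⟨T, hT⟩ : ∃ T : Finset (MvPolynomial σ ℝ), ∀ x, ∃ P ∈ T, F x = P.eval x := by
    have hpoly : ∀ P ∈ S, ∃ q : MvPolynomial σ ℝ,
        MvPolynomial.aeval (fun i (x : σ → ℝ) => x i) q = P := fun P hP => hSR hP
    choose! q hq using hpoly
    classical
    refine ⟨hS.toFinset.image q, fun x => ?_⟩
    obtain ⟨P, hP, hx⟩ := hsel x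
    refine ⟨q P, Finset.mem_image_of_mem q (hS.mem_toFinset.mpr hP), hx.trans ?_⟩
    rw [← MvPolynomial.aeval_proj_apply]
    exact congrFun (hq P hP).symm x
  choose c A hc hA hloj using fun P : MvPolynomial σ ℝ => P.exists_lojasiewicz θ
  obtain ⟨P₀, hP₀, -⟩ := hT θ
  have hTn : T.Nonempty := ⟨P₀, hP₀⟩
  obtain ⟨PA, -, hPA⟩ := T.exists_max_image A hTn
  obtain ⟨Pc, -, hPc⟩ := T.exists_max_image c hTn
  refine ⟨c Pc, A PA, hc Pc, hA PA, ?_⟩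
  have hcP : ∀ P : MvPolynomial σ ℝ, Continuous fun x => P.eval x := fun P =>
    MvPolynomial.continuous_eval P
  have hev : ∀ᶠ x in 𝓝 θ, ∀ P ∈ T, F x = P.eval x → F θ = P.eval θ := by
    refine (Finset.eventually_all T).mpr fun P _ => ?_
    by_cases hP : F θ = P.eval θ
    · exact .of_forall fun _ _ => hP
    · filter_upwards [(isOpen_ne_fun hFc (hcP P)).mem_nhds hP] with x hx h
      exact absurd h hx
  have hgrad : Continuous fun x => ‖fun j => fderiv ℝ F x (Pi.single j 1)‖ :=
    (continuous_pi fun j => (hd.continuous_fderiv one_ne_zero).clm_apply continuous_const).norm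
  let D : MvPolynomial σ ℝ := ∏ PQ ∈ T.offDiag, (PQ.1 - PQ.2)
  have hD : D ≠ 0 := Finset.prod_ne_zero_iff.mpr fun PQ h =>
    sub_ne_zero.mpr (Finset.mem_offDiag.mp h).2.2
  have hloc : ∀ x, D.eval x ≠ 0 → ∀ P ∈ T, F x = P.eval x → F =ᶠ[𝓝 x] fun y => P.eval y := by
    intro x hx P hP hxP
    have : ∀ᶠ y in 𝓝 x, ∀ Q ∈ T, Q ≠ P → F y ≠ Q.eval y := by
      refine (Finset.eventually_all T).mpr fun Q hQ => ?_
      by_cases hQP : Q = P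
      · exact .of_forall fun _ h => absurd hQP h
      · have hne : F x ≠ Q.eval x := by
          intro h
          rw [MvPolynomial.eval_prod, Finset.prod_ne_zero_iff] at hx
          refine hx (Q, P) (Finset.mem_offDiag.mpr ⟨hQ, hP, hQP⟩) ?_
          simp [← h, ← hxP]
        filter_upwards [(isOpen_ne_fun hFc (hcP Q)).mem_nhds hne] with y hy _
        exact hy
    filter_upwards [this] with y hy
    obtain ⟨Q, hQ, hyQ⟩ := hT y
    by_cases hQP : Q = P
    · exact hQP ▸ hyQ
    · exact absurd hyQ (hy Q hQ hQP)
  obtain ⟨V, hV, hVo, hθV⟩ := eventually_nhds_iff.mp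
    (hev.and ((Finset.eventually_all T).mpr fun P _ => hloj P))
  have hgen : ∀ x ∈ V, D.eval x ≠ 0 → ∀ e, A PA ≤ e →
      |F x - F θ| ^ e ≤ c Pc * ‖fun j => fderiv ℝ F x (Pi.single j 1)‖ := by
    intro x hxV hxD e he
    obtain ⟨P, hP, hxP⟩ := hT x
    rw [(hloc x hxD P hP hxP).fderiv_eq, hxP, (hV x hxV).1 P hP hxP]
    simp only [MvPolynomial.fderiv_eval_single]
    refine ((hV x hxV).2 P hP e ((hPA P hP).trans he)).trans ?_
    gcongr
    exact hPc P hP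
  filter_upwards [hVo.mem_nhds hθV] with x hx e he
  have hclosed : IsClosed
      {x | |F x - F θ| ^ e ≤ c Pc * ‖fun j => fderiv ℝ F x (Pi.single j 1)‖} :=
    isClosed_le ((hFc.sub continuous_const).abs.rpow_const fun _ => Or.inr ((hA PA).1.le.trans he))
      (continuous_const.mul hgrad)
  exact closure_minimal (fun y hy => hgen y hy.1 hy.2 e he) hclosed
    ((MvPolynomial.dense_eval_ne_zero hD).open_subset_closure_inter hVo hx)

theorem clipFn_lipschitz (x y : ℝ) : |clipFn x - clipFn y| ≤ |x - y| :=
  (abs_min_sub_min_le_max _ _ _ _).trans (by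
    simpa using abs_max_sub_max_le_abs x y 0)

theorem abs_clipFn_le_one (x : ℝ) : |clipFn x| ≤ 1 := by
  rw [clipFn, abs_of_nonneg (le_min (le_max_right _ _) zero_le_one)]
  exact min_le_right _ _

theorem continuous_clipFn : Continuous clipFn :=
  (continuous_id.max continuous_const).min continuous_const

open Topology in
theorem hasDerivAt_clipFn {y : ℝ} (h0 : y ≠ 0) (h1 : y ≠ 1) :
    HasDerivAt clipFn ((Set.Ioo (0 : ℝ) 1).indicator 1 y) y := by
  rcases lt_or_gt_of_ne h0 with h | h
  · rw [Set.indicator_of_notMem fun hy => absurd hy.1 h.not_gt]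
    refine (hasDerivAt_const y 0).congr_of_eventuallyEq ?_
    filter_upwards [Iio_mem_nhds h] with z hz
    simp [clipFn, (Set.mem_Iio.mp hz).le]
  rcases lt_or_gt_of_ne h1 with h' | h'
  · rw [Set.indicator_of_mem (Set.mem_Ioo.mpr ⟨h, h'⟩)]
    refine (hasDerivAt_id y).congr_of_eventuallyEq ?_
    filter_upwards [Ioo_mem_nhds h h'] with z hz
    simp [clipFn, hz.1.le, hz.2.le]
  · rw [Set.indicator_of_notMem fun hy => absurd hy.2 h'.not_gt]
    refine (hasDerivAt_const y 1).congr_of_eventuallyEq ?_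
    filter_upwards [Ioi_mem_nhds h'] with z hz
    simp [clipFn, (Set.mem_Ioi.mp hz).le]

open Topology in
theorem continuousAt_indicator_Ioo {y : ℝ} (h0 : y ≠ 0) (h1 : y ≠ 1) :
    ContinuousAt ((Set.Ioo (0 : ℝ) 1).indicator (1 : ℝ → ℝ)) y := by
  refine continuous_one.continuousOn.continuousAt_indicator ?_
  simp [frontier_Ioo zero_lt_one, h0, h1]

/-- The derivative of the realization function with respect to the parameters. -/
def realCDeriv {h : ℕ} (v w : Fin h → ℝ) (θ : Fin (h + 1) → ℝ) (x : ℝ) :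
    (Fin (h + 1) → ℝ) →L[ℝ] ℝ :=
  ContinuousLinearMap.proj (Fin.last h) + ∑ i : Fin h,
    v i • (Set.Ioo (0 : ℝ) 1).indicator (1 : ℝ → ℝ) (w i * x + θ i.castSucc) •
      ContinuousLinearMap.proj (R := ℝ) (φ := fun _ => ℝ) i.castSucc

section

variable {h : ℕ} (v w : Fin h → ℝ)

theorem continuous_realC : Continuous fun q : (Fin (h + 1) → ℝ) × ℝ => realC v w q.1 q.2 := by
  have := continuous_clipFn
  unfold realC
  fun_prop

theorem abs_realC_le (θ : Fin (h + 1) → ℝ) (x : ℝ) : |realC v w θ x| ≤ ‖θ‖ + ∑ i, |v i| := by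
  refine (abs_add_le _ _).trans (add_le_add (norm_le_pi_norm θ _)
    ((Finset.abs_sum_le_sum_abs _ _).trans (Finset.sum_le_sum fun i _ => ?_)))
  rw [abs_mul]
  exact mul_le_of_le_one_right (abs_nonneg _) (abs_clipFn_le_one _)

theorem abs_realC_sub_le (θ θ' : Fin (h + 1) → ℝ) (x : ℝ) :
    |realC v w θ x - realC v w θ' x| ≤ (1 + ∑ i, |v i|) * ‖θ - θ'‖ := by
  have : realC v w θ x - realC v w θ' x = (θ - θ') (Fin.last h) + ∑ i : Fin h,
      v i * (clipFn (w i * x + θ i.castSucc) - clipFn (w i * x + θ' i.castSucc)) := by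
    simp only [realC, mul_sub, Finset.sum_sub_distrib, Pi.sub_apply]
    ring
  rw [this, add_mul, one_mul, Finset.sum_mul]
  refine (abs_add_le _ _).trans (add_le_add (norm_le_pi_norm (θ - θ') _)
    ((Finset.abs_sum_le_sum_abs _ _).trans (Finset.sum_le_sum fun i _ => ?_)))
  rw [abs_mul]
  gcongr
  refine (clipFn_lipschitz _ _).trans ?_
  rw [add_sub_add_left_eq_sub]
  exact norm_le_pi_norm (θ - θ') i.castSucc

theorem norm_realCDeriv_le (θ : Fin (h + 1) → ℝ) (x : ℝ) :
    ‖realCDeriv v w θ x‖ ≤ 1 + ∑ i, |v i| := by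
  refine ContinuousLinearMap.opNorm_le_bound _ (by positivity) fun z => ?_
  rw [add_mul, one_mul, Finset.sum_mul]
  simp only [realCDeriv, add_apply, sum_apply, smul_apply, ContinuousLinearMap.proj_apply]
  refine (norm_add_le _ _).trans (add_le_add (norm_le_pi_norm _ _)
    ((norm_sum_le _ _).trans (Finset.sum_le_sum fun i _ => ?_)))
  rw [norm_smul, norm_smul, Real.norm_eq_abs (v i)]
  gcongr
  refine (mul_le_of_le_one_left (norm_nonneg _) ?_).trans (norm_le_pi_norm _ _)
  refine (norm_indicator_le_norm_self _ _).trans ?_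
  simp

theorem measurable_realCDeriv (θ : Fin (h + 1) → ℝ) : Measurable (realCDeriv v w θ) := by
  unfold realCDeriv
  have : Measurable ((Set.Ioo (0 : ℝ) 1).indicator (1 : ℝ → ℝ)) :=
    measurable_one.indicator measurableSet_Ioo
  refine measurable_const.add (Finset.measurable_sum _ fun i _ => ?_)
  have hi : Measurable fun x => (Set.Ioo (0 : ℝ) 1).indicator (1 : ℝ → ℝ)
      (w i * x + θ i.castSucc) :=
    this.comp ((measurable_id.const_mul (w i)).add_const _)
  refine Measurable.const_smul ?_ (v i)
  exact hi.smul_const _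

variable {w}

theorem ae_affine_ne (hw : ∀ i, w i ≠ 0) (μ : Measure ℝ) [NullSingletonClass μ] (θ : Fin (h + 1) → ℝ) :
    ∀ᵐ x ∂μ, ∀ i : Fin h, w i * x + θ i.castSucc ≠ 0 ∧ w i * x + θ i.castSucc ≠ 1 := by
  refine ae_all_iff.mpr fun i => ?_
  filter_upwards [Measure.ae_ne μ ((0 - θ i.castSucc) / w i),
    Measure.ae_ne μ ((1 - θ i.castSucc) / w i)] with x h0 h1
  rw [ne_eq, eq_div_iff (hw i)] at h0 h1
  exact ⟨fun h => h0 (by linarith), fun h => h1 (by linarith)⟩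

theorem hasFDerivAt_realC {θ : Fin (h + 1) → ℝ} {x : ℝ}
    (hx : ∀ i : Fin h, w i * x + θ i.castSucc ≠ 0 ∧ w i * x + θ i.castSucc ≠ 1) :
    HasFDerivAt (fun θ => realC v w θ x) (realCDeriv v w θ x) θ := by
  have hproj : ∀ i : Fin (h + 1), HasFDerivAt (fun θ : Fin (h + 1) → ℝ => θ i)
    (ContinuousLinearMap.proj (R := ℝ) (φ := fun _ => ℝ) i) θ := fun i => hasFDerivAt_apply i θ
  exact (hproj _).add (.fun_sum fun i _ => HasFDerivAt.const_mul
    ((hasDerivAt_clipFn (hx i).1 (hx i).2).comp_hasFDerivAt θ ((hproj _).const_add _)) _)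

theorem continuousAt_realCDeriv {θ : Fin (h + 1) → ℝ} {x : ℝ}
    (hx : ∀ i : Fin h, w i * x + θ i.castSucc ≠ 0 ∧ w i * x + θ i.castSucc ≠ 1) :
    ContinuousAt (fun θ => realCDeriv v w θ x) θ := by
  refine continuousAt_const.add (tendsto_finsetSum _ fun i _ => ?_)
  refine Tendsto.const_smul ?_ (v i)
  refine Tendsto.smul_const ?_ _
  exact ContinuousAt.comp (f := fun θ : Fin (h + 1) → ℝ => w i * x + θ i.castSucc)
    (g := (Set.Ioo (0 : ℝ) 1).indicator 1) (continuousAt_indicator_Ioo (hx i).1 (hx i).2)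
    (continuous_const.add (continuous_apply i.castSucc)).continuousAt

theorem riskC_contDiff (a b : ℝ) (hw : ∀ i, w i ≠ 0) {f p : ℝ → ℝ} (hf : Continuous f)
    (hp : Continuous p) : ContDiff ℝ 1 (riskC a b v w f p) := by
  obtain ⟨Cf, hCf⟩ := isCompact_Icc.exists_bound_of_continuousOn (hf.continuousOn (s := Set.Icc a b))
  obtain ⟨Cp, hCp⟩ := isCompact_Icc.exists_bound_of_continuousOn (hp.continuousOn (s := Set.Icc a b))
  set μ := volume.restrict (Set.Ioo a b) with hμ
  have hmem : ∀ᵐ x ∂μ, x ∈ Set.Icc a b :=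
    (ae_restrict_mem measurableSet_Ioo).mono fun x hx => Set.Ioo_subset_Icc_self hx
  have hcont : ∀ θ, Continuous (realC v w θ) := fun θ =>
    (continuous_realC v w).comp (Continuous.prodMk_right θ)
  set K := 1 + ∑ i, |v i| with hK
  have hK0 : 0 ≤ K := by positivity
  let D : (Fin (h + 1) → ℝ) → ℝ → (Fin (h + 1) → ℝ) →L[ℝ] ℝ := fun θ x =>
    (2 * (realC v w θ x - f x) * p x) • realCDeriv v w θ x
  have hDmeas : ∀ θ, AEStronglyMeasurable (D θ) μ := fun θ =>
    ((((hcont θ).sub hf).const_mul 2).mul hp).aestronglyMeasurable.smul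
      (measurable_realCDeriv v w θ).aestronglyMeasurable
  have hbound : ∀ θ₀, ∀ θ ∈ Metric.ball θ₀ 1, ∀ x ∈ Set.Icc a b,
      |realC v w θ x - f x| ≤ ‖θ₀‖ + K + Cf := by
    intro θ₀ θ hθ x hx
    have hθn : ‖θ‖ ≤ ‖θ₀‖ + 1 := by
      have := norm_sub_norm_le θ θ₀
      have := (mem_ball_iff_norm.mp hθ).le
      linarith
    refine (abs_sub _ _).trans ?_
    have h1 := abs_realC_le v w θ x
    have h2 := hCf x hx
    rw [Real.norm_eq_abs] at h2
    linarith
  refine contDiff_one_iff_hasFDerivAt.mpr ⟨fun θ => ∫ x, D θ x ∂μ, ?_, fun θ => ?_⟩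
  · refine continuous_iff_continuousAt.mpr fun θ => ?_
    refine continuousAt_of_dominated (bound := fun _ => 2 * (‖θ‖ + K + Cf) * Cp * K)
      (.of_forall hDmeas) ?_ (integrable_const _) ?_
    · filter_upwards [Metric.ball_mem_nhds θ one_pos] with θ' hθ'
      filter_upwards [hmem] with x hx
      have h1 := hbound θ θ' hθ' x hx
      have h2 := hCp x hx
      rw [norm_smul, norm_mul, norm_mul, Real.norm_two, Real.norm_eq_abs (_ - _)]
      gcongr
      · exact mul_nonneg (mul_nonneg zero_le_two ((abs_nonneg _).trans h1))
          ((norm_nonneg _).trans h2)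
      · exact mul_nonneg zero_le_two ((abs_nonneg _).trans h1)
      · exact norm_realCDeriv_le v w θ' x
    · filter_upwards [ae_affine_ne hw μ θ] with x hx
      have h1 : Continuous fun θ => realC v w θ x :=
        (continuous_realC v w).comp (Continuous.prodMk_left x)
      exact (((h1.sub continuous_const).const_mul 2).mul_const _).continuousAt.smul
        (continuousAt_realCDeriv v hx)
  · refine (hasFDerivAt_integral_of_dominated_loc_of_lip (Metric.ball_mem_nhds θ one_pos)
      (F := fun θ x => (realC v w θ x - f x) ^ 2 * p x)
      (bound := fun _ => 2 * (‖θ‖ + K + Cf) * Cp * K)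
      (.of_forall fun θ => ((((hcont θ).sub hf).pow 2).mul hp).aestronglyMeasurable)
      ?_ (hDmeas θ) ?_ (integrable_const _) ?_).2
    · exact ((((hcont θ).sub hf).pow 2).mul hp).integrableOn_Icc.mono_set Set.Ioo_subset_Icc_self
    · filter_upwards [hmem] with x hx
      refine LipschitzOnWith.of_dist_le_mul fun θ₁ h₁ θ₂ h₂ => ?_
      have hb₁ := hbound θ θ₁ h₁ x hx
      have hb₂ := hbound θ θ₂ h₂ x hx
      have hb₃ := hCp x hx
      have hC0 := (abs_nonneg _).trans hb₁
      have hCp0 := (norm_nonneg _).trans hb₃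
      rw [Real.coe_nnabs, abs_of_nonneg (by positivity), Real.dist_eq, dist_eq_norm]
      have : (realC v w θ₁ x - f x) ^ 2 * p x - (realC v w θ₂ x - f x) ^ 2 * p x =
          ((realC v w θ₁ x - f x) + (realC v w θ₂ x - f x)) * p x *
            (realC v w θ₁ x - realC v w θ₂ x) := by ring
      rw [this, abs_mul, abs_mul, mul_assoc (2 * (‖θ‖ + K + Cf) * Cp)]
      have hsum : |(realC v w θ₁ x - f x) + (realC v w θ₂ x - f x)| ≤ 2 * (‖θ‖ + K + Cf) :=
        (abs_add_le _ _).trans (by linarith)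
      gcongr
      · exact hb₃
      · exact abs_realC_sub_le v w θ₁ θ₂ x
    · filter_upwards [ae_affine_ne hw μ θ] with x hx
      refine ((((hasFDerivAt_realC v hx).sub_const (f x)).pow 2).mul_const (p x)).congr_fderiv ?_
      ext z
      simp only [D, smul_apply, smul_eq_mul, nsmul_eq_mul]
      ring

end

theorem norm_le_euclNorm {n : ℕ} (x : Fin n → ℝ) : ‖x‖ ≤ euclNorm x := by
  refine (pi_norm_le_iff_of_nonneg (Real.sqrt_nonneg _)).mpr fun i => ?_
  rw [Real.norm_eq_abs, ← Real.sqrt_sq_eq_abs]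
  exact Real.sqrt_le_sqrt (Finset.single_le_sum (f := fun i => x i ^ 2)
    (fun i _ => sq_nonneg _) (Finset.mem_univ i))

theorem statement_10
    (a b : ℝ) (hab : a < b) (h : ℕ) (hh : 0 < h)
    (v w : Fin h → ℝ) (hv : ∀ i, 0 < v i) (hw : ∀ i, 0 < w i)
    (f p : ℝ → ℝ) (hf : Continuous f) (hp : Continuous p)
    (hpnn : ∀ x : ℝ, 0 ≤ p x) (hsupp : {x : ℝ | 0 < p x} = Set.Ioo a b)
    (hfpp : PiecewisePoly f) (hppp : PiecewisePoly p)
    (θ : Fin (h + 1) → ℝ) :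
    ∃ ε c A : ℝ, 0 < ε ∧ 0 < c ∧ A ∈ Set.Ioo (0 : ℝ) 1 ∧
      ∀ ϑ : Fin (h + 1) → ℝ, euclNorm (ϑ - θ) < ε →
        ∀ e ∈ Set.Ioc A 1,
          |riskC a b v w f p θ - riskC a b v w f p ϑ| ^ e ≤
            c * euclNorm (gradC a b v w f p ϑ) := by
  obtain ⟨c, A, hc, hA, hev⟩ := (riskC_isFinSelection hab.le hw (v := v)
    (hfpp.isFinSelection hf) (hppp.isFinSelection hp)).exists_lojasiewicz
      (riskC_contDiff v a b (fun i => (hw i).ne') hf hp) θ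
  obtain ⟨ε, hε, hball⟩ := Metric.eventually_nhds_iff.mp hev
  refine ⟨ε, c, A, hε, hc, hA, fun ϑ hϑ e he => ?_⟩
  rw [abs_sub_comm]
  refine (hball (dist_eq_norm ϑ θ ▸ (norm_le_euclNorm _).trans_lt hϑ) e he.1.le).trans ?_
  gcongr
  exact norm_le_euclNorm (gradC a b v w f p ϑ)
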